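/- arXiv:2207.03744 — 2 statements merged into one kernel-verified Lean document; each statement's English description precedes it below -/
import Mathlib

section
/- Let N ≥ 1, Q = 2N + 2, and suppose 1 < p < Q/(Q − 2). Let u₀ ∈ L¹_loc(ℝ^{2N+1}) be nonnegative and let f ∈ L¹(ℝ^{2N+1}) satisfy ∫_{ℝ^{2N+1}} f(η) dη > 0. Then the problem u_t − Δ_ℍ u = |u|^p + f, u(0, ·) = u₀, admits no global weak solution: there is no u ∈ L^p_loc((0, ∞) × ℝ^{2N+1}) which, for every T > 0, is a weak solution on (0, T). -/
open MeasureTheory Real Set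

noncomputable section

/-- Points of the Heisenberg group `ℍ^N`, written `η = (x, y, τ)`. -/
abbrev Heis (N : ℕ) : Type := (Fin N → ℝ) × (Fin N → ℝ) × ℝ

/-- Partial derivative `∂u/∂x_i`. -/
def pdx {N : ℕ} (i : Fin N) (u : Heis N → ℝ) (η : Heis N) : ℝ :=
  deriv (fun s => u (Function.update η.1 i s, η.2.1, η.2.2)) (η.1 i)

/-- Partial derivative `∂u/∂y_i`. -/
def pdy {N : ℕ} (i : Fin N) (u : Heis N → ℝ) (η : Heis N) : ℝ :=
  deriv (fun s => u (η.1, Function.update η.2.1 i s, η.2.2)) (η.2.1 i)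

/-- Partial derivative `∂u/∂τ`. -/
def pdt {N : ℕ} (u : Heis N → ℝ) (η : Heis N) : ℝ :=
  deriv (fun s => u (η.1, η.2.1, s)) η.2.2

/-- The sub-Laplacian on the Heisenberg group, in its explicit second-order form
`Δ_ℍ u = Σ_i (∂²u/∂x_i² + ∂²u/∂y_i² + 4 y_i ∂²u/(∂x_i ∂τ) − 4 x_i ∂²u/(∂y_i ∂τ)
  + 4 (x_i² + y_i²) ∂²u/∂τ²)`. -/
def subLaplacian {N : ℕ} (u : Heis N → ℝ) (η : Heis N) : ℝ :=
  ∑ i : Fin N,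
    (pdx i (pdx i u) η + pdy i (pdy i u) η
      + 4 * η.2.1 i * pdx i (pdt u) η
      - 4 * η.1 i * pdy i (pdt u) η
      + 4 * ((η.1 i) ^ 2 + (η.2.1 i) ^ 2) * pdt (pdt u) η)

/-- `|η|_ℍ⁴ = (|x|² + |y|²)² + τ²`. -/
def heisNorm4 {N : ℕ} (η : Heis N) : ℝ :=
  ((∑ i : Fin N, (η.1 i) ^ 2) + (∑ i : Fin N, (η.2.1 i) ^ 2)) ^ 2 + η.2.2 ^ 2

/-- The homogeneous norm `|η|_ℍ = ((|x|² + |y|²)² + τ²)^{1/4}`. -/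
def heisNorm {N : ℕ} (η : Heis N) : ℝ := heisNorm4 η ^ ((4 : ℝ)⁻¹)

/-- An admissible test function on `(0,T) × ℍ^N`: nonnegative, (at least) `C²`,
compactly supported, and vanishing at time `T`. -/
def IsTestFun (N : ℕ) (T : ℝ) (ψ : ℝ × Heis N → ℝ) : Prop :=
  ContDiff ℝ 2 ψ ∧ HasCompactSupport ψ ∧ (∀ z, 0 ≤ ψ z) ∧ ∀ η, ψ (T, η) = 0

/-- `u` is a weak solution of `u_t − Δ_ℍ u = |u|^p + f`, `u(0,·) = u₀`, on `(0,T)`. -/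
def IsWeakSol (N : ℕ) (p T : ℝ) (u₀ f : Heis N → ℝ) (u : ℝ × Heis N → ℝ) : Prop :=
  LocallyIntegrableOn u (Ioo (0 : ℝ) T ×ˢ (univ : Set (Heis N))) volume ∧
  LocallyIntegrableOn (fun z => |u z| ^ p) (Ioo (0 : ℝ) T ×ˢ (univ : Set (Heis N))) volume ∧
  ∀ ψ : ℝ × Heis N → ℝ, IsTestFun N T ψ →
    (∫ t in Ioo (0 : ℝ) T, ∫ η, |u (t, η)| ^ p * ψ (t, η))
      + (∫ η, u₀ η * ψ (0, η))
      + (∫ t in Ioo (0 : ℝ) T, ∫ η, f η * ψ (t, η))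
    = -(∫ t in Ioo (0 : ℝ) T, ∫ η, u (t, η) * deriv (fun s => ψ (s, η)) t)
      - (∫ t in Ioo (0 : ℝ) T, ∫ η, u (t, η) * subLaplacian (fun ξ => ψ (t, ξ)) η)

section SubLaplacian

variable {N : ℕ}

lemma pdx_eq_fderiv {u : Heis N → ℝ} (hu : Differentiable ℝ u) (i : Fin N) :
    pdx i u = fun η => fderiv ℝ u η (Pi.single i 1, 0, 0) := by
  funext η
  have h1 : HasDerivAt (fun s : ℝ => ((Function.update η.1 i s, η.2.1, η.2.2) : Heis N))
      (Pi.single i 1, 0, 0) (η.1 i) :=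
    (hasDerivAt_update η.1 i (η.1 i)).prodMk
      ((hasDerivAt_const _ η.2.1).prodMk (hasDerivAt_const _ η.2.2))
  have h2 : HasFDerivAt u (fderiv ℝ u η) (Function.update η.1 i (η.1 i), η.2.1, η.2.2) := by
    rw [Function.update_eq_self]
    exact (hu η).hasFDerivAt
  exact (h2.comp_hasDerivAt (η.1 i) h1).deriv

lemma pdy_eq_fderiv {u : Heis N → ℝ} (hu : Differentiable ℝ u) (i : Fin N) :
    pdy i u = fun η => fderiv ℝ u η (0, Pi.single i 1, 0) := by
  funext η
  have h1 : HasDerivAt (fun s : ℝ => ((η.1, Function.update η.2.1 i s, η.2.2) : Heis N))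
      (0, Pi.single i 1, 0) (η.2.1 i) :=
    (hasDerivAt_const _ η.1).prodMk
      ((hasDerivAt_update η.2.1 i (η.2.1 i)).prodMk (hasDerivAt_const _ η.2.2))
  have h2 : HasFDerivAt u (fderiv ℝ u η) (η.1, Function.update η.2.1 i (η.2.1 i), η.2.2) := by
    rw [Function.update_eq_self]
    exact (hu η).hasFDerivAt
  exact (h2.comp_hasDerivAt (η.2.1 i) h1).deriv

lemma pdt_eq_fderiv {u : Heis N → ℝ} (hu : Differentiable ℝ u) :
    pdt u = fun η => fderiv ℝ u η (0, 0, 1) := by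
  funext η
  have h1 : HasDerivAt (fun s : ℝ => ((η.1, η.2.1, s) : Heis N)) (0, 0, 1) η.2.2 :=
    (hasDerivAt_const _ η.1).prodMk ((hasDerivAt_const _ η.2.1).prodMk (hasDerivAt_id _))
  have h2 : HasFDerivAt u (fderiv ℝ u η) (η.1, η.2.1, η.2.2) := (hu η).hasFDerivAt
  exact (h2.comp_hasDerivAt η.2.2 h1).deriv

lemma contDiff_fderiv_const_apply {E : Type*} [NormedAddCommGroup E] [NormedSpace ℝ E]
    {u : E → ℝ} (hu : ContDiff ℝ 2 u) (v : E) : ContDiff ℝ 1 (fun η => fderiv ℝ u η v) :=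
  (hu.fderiv_right (m := 1) (by norm_num)).clm_apply contDiff_const

lemma exists_fderiv_fderiv_pow {E : Type*} [NormedAddCommGroup E] [NormedSpace ℝ E]
    {g : E → ℝ} (hg : ContDiff ℝ 2 g) (n : ℕ) (v w : E) :
    ∃ H : E → ℝ, Continuous H ∧ ∀ η,
      fderiv ℝ (fun ξ => fderiv ℝ (fun ζ => g ζ ^ (n + 2)) ξ w) η v = g η ^ n * H η := by
  have hgd : Differentiable ℝ g := hg.differentiable (by norm_num)
  have hw := contDiff_fderiv_const_apply hg w
  have hv := contDiff_fderiv_const_apply hg v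
  have hwd : Differentiable ℝ (fun η => fderiv ℝ g η w) := hw.differentiable (by norm_num)
  have hvw : Continuous (fun η => fderiv ℝ (fun ξ => fderiv ℝ g ξ w) η v) :=
    (hw.continuous_fderiv (by norm_num)).clm_apply continuous_const
  refine ⟨fun η => (n + 2) * (n + 1) * (fderiv ℝ g η v * fderiv ℝ g η w)
    + (n + 2) * (g η * fderiv ℝ (fun ξ => fderiv ℝ g ξ w) η v), ?_, fun η => ?_⟩
  · have := hw.continuous
    have := hv.continuous
    have := hg.continuous
    fun_prop
  · have h1 : (fun ξ => fderiv ℝ (fun ζ => g ζ ^ (n + 2)) ξ w)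
        = fun ξ => (n + 2 : ℝ) * (g ξ ^ (n + 1) * fderiv ℝ g ξ w) := by
      funext ξ
      rw [((hgd ξ).hasFDerivAt.pow (n + 2)).fderiv]
      simp
      ring
    have h2 : HasFDerivAt (fun ξ => (n + 2 : ℝ) * (g ξ ^ (n + 1) * fderiv ℝ g ξ w)) _ η :=
      (((hgd η).hasFDerivAt.pow (n + 1)).mul (hwd η).hasFDerivAt).const_mul (n + 2 : ℝ)
    rw [h1, h2.fderiv]
    simp
    ring

lemma subLaplacian_eq_fderiv {u : Heis N → ℝ} (hu : ContDiff ℝ 2 u) (η : Heis N) :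
    subLaplacian u η = ∑ i : Fin N,
      (fderiv ℝ (fun ξ => fderiv ℝ u ξ (Pi.single i 1, 0, 0)) η (Pi.single i 1, 0, 0)
      + fderiv ℝ (fun ξ => fderiv ℝ u ξ (0, Pi.single i 1, 0)) η (0, Pi.single i 1, 0)
      + 4 * η.2.1 i * fderiv ℝ (fun ξ => fderiv ℝ u ξ (0, 0, 1)) η (Pi.single i 1, 0, 0)
      - 4 * η.1 i * fderiv ℝ (fun ξ => fderiv ℝ u ξ (0, 0, 1)) η (0, Pi.single i 1, 0)
      + 4 * ((η.1 i) ^ 2 + (η.2.1 i) ^ 2) *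
        fderiv ℝ (fun ξ => fderiv ℝ u ξ (0, 0, 1)) η (0, 0, 1)) := by
  have hd : Differentiable ℝ u := hu.differentiable (by norm_num)
  have h2 (v : Heis N) : Differentiable ℝ (fun ξ => fderiv ℝ u ξ v) :=
    (contDiff_fderiv_const_apply hu v).differentiable (by norm_num)
  unfold subLaplacian
  refine Finset.sum_congr rfl fun i _ => ?_
  simp only [pdx_eq_fderiv hd, pdy_eq_fderiv hd, pdt_eq_fderiv hd, pdx_eq_fderiv (h2 _),
    pdy_eq_fderiv (h2 _), pdt_eq_fderiv (h2 _)]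

lemma exists_subLaplacian_pow {g : Heis N → ℝ} (hg : ContDiff ℝ 2 g) (n : ℕ) :
    ∃ H : Heis N → ℝ, Continuous H ∧
      ∀ η, subLaplacian (fun ξ => g ξ ^ (n + 2)) η = g η ^ n * H η := by
  choose H hHc hH using fun v w : Heis N => exists_fderiv_fderiv_pow hg n v w
  refine ⟨fun η => ∑ i : Fin N,
      (H (Pi.single i 1, 0, 0) (Pi.single i 1, 0, 0) η
      + H (0, Pi.single i 1, 0) (0, Pi.single i 1, 0) η
      + 4 * η.2.1 i * H (Pi.single i 1, 0, 0) (0, 0, 1) η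
      - 4 * η.1 i * H (0, Pi.single i 1, 0) (0, 0, 1) η
      + 4 * ((η.1 i) ^ 2 + (η.2.1 i) ^ 2) * H (0, 0, 1) (0, 0, 1) η), ?_, fun η => ?_⟩
  · fun_prop
  · rw [subLaplacian_eq_fderiv (hg.pow _), Finset.mul_sum]
    refine Finset.sum_congr rfl fun i _ => ?_
    simp only [hH]
    ring

lemma pdx_const_mul (c : ℝ) (i : Fin N) (u : Heis N → ℝ) :
    pdx i (fun ξ => c * u ξ) = fun ξ => c * pdx i u ξ :=
  funext fun _ => deriv_const_mul_field c

lemma pdy_const_mul (c : ℝ) (i : Fin N) (u : Heis N → ℝ) :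
    pdy i (fun ξ => c * u ξ) = fun ξ => c * pdy i u ξ :=
  funext fun _ => deriv_const_mul_field c

lemma pdt_const_mul (c : ℝ) (u : Heis N → ℝ) :
    pdt (fun ξ => c * u ξ) = fun ξ => c * pdt u ξ :=
  funext fun _ => deriv_const_mul_field c

lemma subLaplacian_const_mul (c : ℝ) (u : Heis N → ℝ) (η : Heis N) :
    subLaplacian (fun ξ => c * u ξ) η = c * subLaplacian u η := by
  unfold subLaplacian
  rw [Finset.mul_sum]
  refine Finset.sum_congr rfl fun i _ => ?_
  simp only [pdx_const_mul, pdy_const_mul, pdt_const_mul]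
  ring

/-- The anisotropic dilation `δ_c (x, y, τ) = (c x, c y, c² τ)`. -/
def heisDilate (c : ℝ) (η : Heis N) : Heis N := (c • η.1, c • η.2.1, c ^ 2 * η.2.2)

lemma contDiff_heisDilate (c : ℝ) : ContDiff ℝ 2 (heisDilate c : Heis N → Heis N) := by
  unfold heisDilate
  fun_prop

lemma subLaplacian_comp_heisDilate (c : ℝ) (u : Heis N → ℝ) (η : Heis N) :
    subLaplacian (fun ξ => u (heisDilate c ξ)) η = c ^ 2 * subLaplacian u (heisDilate c η) := by
  have hupd (x : Fin N → ℝ) (i : Fin N) (s : ℝ) :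
      c • Function.update x i s = Function.update (c • x) i (c * s) := by
    rw [← Function.update_smul, smul_eq_mul]
  have hx (i : Fin N) (v : Heis N → ℝ) : pdx i (fun ξ => v (heisDilate c ξ))
      = fun ξ => c * pdx i v (heisDilate c ξ) := by
    funext ξ
    simp only [pdx, heisDilate, hupd]
    exact deriv_comp_mul_left c
      (fun s => v (Function.update (c • ξ.1) i s, c • ξ.2.1, c ^ 2 * ξ.2.2)) (ξ.1 i)
  have hy (i : Fin N) (v : Heis N → ℝ) : pdy i (fun ξ => v (heisDilate c ξ))
      = fun ξ => c * pdy i v (heisDilate c ξ) := by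
    funext ξ
    simp only [pdy, heisDilate, hupd]
    exact deriv_comp_mul_left c
      (fun s => v (c • ξ.1, Function.update (c • ξ.2.1) i s, c ^ 2 * ξ.2.2)) (ξ.2.1 i)
  have ht (v : Heis N → ℝ) : pdt (fun ξ => v (heisDilate c ξ))
      = fun ξ => c ^ 2 * pdt v (heisDilate c ξ) := by
    funext ξ
    exact deriv_comp_mul_left (c ^ 2) (fun s => v (c • ξ.1, c • ξ.2.1, s)) ξ.2.2
  unfold subLaplacian
  rw [Finset.mul_sum]
  refine Finset.sum_congr rfl fun i _ => ?_
  simp only [hx, hy, ht, pdx_const_mul, pdy_const_mul, pdt_const_mul]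
  simp only [heisDilate, Pi.smul_apply, smul_eq_mul]
  ring

end SubLaplacian

lemma mul_mul_pow_le_rpow_mul_pow_add {p q : ℝ} (hpq : p.HolderConjugate q) {n : ℕ}
    (hn : 2 ≤ n * (p - 1)) {w U K : ℝ} (hw0 : 0 ≤ w) (hw1 : w ≤ 1) (hU : 0 ≤ U) (hK : 0 ≤ K) :
    U * (K * w ^ n) ≤ U ^ p * w ^ (n + 2) + K ^ q := by
  have hp := hpq.lt
  have hp0 : 0 < p := by linarith
  have hn0 : (0 : ℝ) < n := by
    by_contra h
    have : (n : ℝ) = 0 := le_antisymm (not_lt.mp h) n.cast_nonneg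
    rw [this] at hn
    linarith
  have h1 : w ^ n ≤ (w ^ (n + 2)) ^ p⁻¹ := by
    rw [← Real.rpow_natCast w n, ← Real.rpow_natCast w (n + 2), ← Real.rpow_mul hw0]
    refine Real.rpow_le_rpow_of_exponent_ge' hw0 hw1 (by positivity) ?_
    rw [← div_eq_mul_inv, div_le_iff₀ hp0]
    push_cast
    linarith
  have hy := Real.young_inequality_of_nonneg (a := U * (w ^ (n + 2)) ^ p⁻¹) (b := K)
    (by positivity) hK hpq
  have h2 : (U * (w ^ (n + 2)) ^ p⁻¹) ^ p = U ^ p * w ^ (n + 2) := by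
    rw [Real.mul_rpow hU (by positivity), Real.rpow_inv_rpow (by positivity) hp0.ne']
  rw [h2] at hy
  calc U * (K * w ^ n) = U * w ^ n * K := by ring
    _ ≤ U * (w ^ (n + 2)) ^ p⁻¹ * K := by gcongr
    _ ≤ _ := hy
    _ ≤ _ := add_le_add (div_le_self (by positivity) hp.le)
      (div_le_self (by positivity) hpq.symm.lt.le)

lemma setIntegral_Ioo_integral_eq {N : ℕ} {T : ℝ} {S : Set (ℝ × Heis N)}
    (hST : S ⊆ Ioo 0 T ×ˢ univ) {F : ℝ × Heis N → ℝ} (hF : Integrable F)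
    (hFS : ∀ z ∉ S, F z = 0) :
    ∫ t in Ioo (0 : ℝ) T, ∫ η, F (t, η) = ∫ z, F z := by
  rw [setIntegral_eq_integral_of_forall_compl_eq_zero]
  · exact (integral_prod F hF).symm
  · intro t ht
    rw [integral_eq_zero_of_ae]
    exact Filter.Eventually.of_forall fun η => hFS _ fun h => ht (hST h).1

lemma integrable_mul_of_continuous {X : Type*} [TopologicalSpace X] [T2Space X]
    [MeasurableSpace X] [OpensMeasurableSpace X] {μ : Measure X} {S : Set X} (hS : IsCompact S)
    {v D : X → ℝ} (hv : IntegrableOn v S μ) (hD : Continuous D) (hDS : ∀ z ∉ S, D z = 0) :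
    Integrable (fun z => v z * D z) μ := by
  refine (integrableOn_iff_integrable_of_support_subset ?_).mp
    (hv.mul_continuousOn hD.continuousOn hS)
  intro z hz
  by_contra h
  exact hz (by simp [hDS z h])

lemma IsWeakSol.setIntegral_source_le {N : ℕ} {p T B : ℝ} {u₀ f : Heis N → ℝ}
    {u : ℝ × Heis N → ℝ} (hu : IsWeakSol N p T u₀ f u) {ψ : ℝ × Heis N → ℝ}
    (hψ : IsTestFun N T ψ) (hψ0 : ∀ η, ψ (0, η) = 0) {S : Set (ℝ × Heis N)} (hS : IsCompact S)
    (hST : S ⊆ Ioo 0 T ×ˢ univ) (hψS : ∀ z ∉ S, ψ z = 0) {D E : ℝ × Heis N → ℝ}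
    (hD : ∀ t η, deriv (fun s => ψ (s, η)) t = D (t, η))
    (hE : ∀ t η, subLaplacian (fun ξ => ψ (t, ξ)) η = E (t, η))
    (hDc : Continuous D) (hEc : Continuous E) (hDS : ∀ z ∉ S, D z = 0) (hES : ∀ z ∉ S, E z = 0)
    (hB : ∀ U ≥ 0, ∀ z, U * |D z + E z| ≤ U ^ p * ψ z + B) :
    ∫ t in Ioo (0 : ℝ) T, ∫ η, f η * ψ (t, η) ≤ B * volume.real S := by
  obtain ⟨hu1, hup, hw⟩ := hu
  have key := hw ψ hψ
  have hu1S := hu1.integrableOn_compact_subset hST hS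
  have hupS := hup.integrableOn_compact_subset hST hS
  have iP := integrable_mul_of_continuous hS hupS hψ.1.continuous hψS
  have iD := integrable_mul_of_continuous hS hu1S hDc hDS
  have iE := integrable_mul_of_continuous hS hu1S hEc hES
  have iB : Integrable (S.indicator fun _ => B) (volume : Measure (ℝ × Heis N)) :=
    (integrable_indicator_iff hS.measurableSet).mpr
      (integrableOn_const (hS.measure_lt_top.ne))
  simp only [hD, hE, hψ0, mul_zero, integral_zero, add_zero] at key
  rw [setIntegral_Ioo_integral_eq hST iP (fun z hz => by simp [hψS z hz]),
    setIntegral_Ioo_integral_eq hST iD (fun z hz => by simp [hDS z hz]),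
    setIntegral_Ioo_integral_eq hST iE (fun z hz => by simp [hES z hz])] at key
  have hmono : -(∫ z, (u z * D z + u z * E z))
      ≤ ∫ z, (|u z| ^ p * ψ z + S.indicator (fun _ => B) z) := by
    rw [← integral_neg]
    refine integral_mono (iD.add iE).neg (iP.add iB) fun z => ?_
    by_cases hz : z ∈ S
    · simp only [indicator_of_mem hz]
      refine le_trans ?_ (hB _ (abs_nonneg (u z)) z)
      rw [← abs_mul, ← mul_add]
      exact neg_le_abs _
    · simp [indicator_of_notMem hz, hψS z hz, hDS z hz, hES z hz]
  rw [integral_add iD iE, integral_add iP iB, integral_indicator_const _ hS.measurableSet,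
    smul_eq_mul] at hmono
  linarith

/-- The parabolic cylinder of scale `R`, at times comparable to `R²`. -/
def heisCylinder (N : ℕ) (R : ℝ) : Set (ℝ × Heis N) :=
  Icc (R ^ 2) (3 * R ^ 2) ×ˢ (Metric.closedBall 0 (2 * R) ×ˢ
    (Metric.closedBall 0 (2 * R) ×ˢ Metric.closedBall 0 (2 * R ^ 2)))

lemma isCompact_heisCylinder (N : ℕ) (R : ℝ) : IsCompact (heisCylinder N R) :=
  isCompact_Icc.prod ((isCompact_closedBall _ _).prod
    ((isCompact_closedBall _ _).prod (isCompact_closedBall _ _)))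

lemma volume_real_heisCylinder (N : ℕ) {R : ℝ} (hR : 0 < R) :
    volume.real (heisCylinder N R) = 2 * 4 ^ (2 * N + 1) * (R ^ 2 * R ^ (2 * N + 2)) := by
  have h1 : (volume : Measure (Fin N → ℝ)).real (Metric.closedBall 0 (2 * R)) = (4 * R) ^ N := by
    rw [measureReal_def, Real.volume_pi_closedBall _ (by positivity),
      ENNReal.toReal_ofReal (by positivity), Fintype.card_fin]
    ring
  have h2 : (volume : Measure ℝ).real (Metric.closedBall 0 (2 * R ^ 2)) = 4 * R ^ 2 := by
    rw [measureReal_def, Real.volume_closedBall, ENNReal.toReal_ofReal (by positivity)]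
    ring
  have h3 : (volume : Measure ℝ).real (Icc (R ^ 2) (3 * R ^ 2)) = 2 * R ^ 2 := by
    rw [measureReal_def, Real.volume_Icc, ENNReal.toReal_ofReal (by nlinarith [sq_nonneg R])]
    ring
  unfold heisCylinder
  rw [Measure.volume_eq_prod, measureReal_prod_prod, Measure.volume_eq_prod,
    measureReal_prod_prod, Measure.volume_eq_prod, measureReal_prod_prod, h1, h2, h3]
  ring

lemma exists_abs_pow_mul_le {X : Type*} [TopologicalSpace X] {g H : X → ℝ} {s : Set X}
    (hs : IsCompact s) (hH : Continuous H) (hgs : ∀ x ∉ s, g x = 0) (hg0 : ∀ x, 0 ≤ g x)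
    {n : ℕ} (hn : n ≠ 0) : ∃ M ≥ 0, ∀ x, |g x ^ n * H x| ≤ M * g x ^ n := by
  obtain ⟨M, hM⟩ := hs.exists_bound_of_continuousOn hH.continuousOn
  refine ⟨max M 0, le_max_right _ _, fun x => ?_⟩
  by_cases hx : x ∈ s
  · rw [abs_mul, abs_of_nonneg (pow_nonneg (hg0 x) n), mul_comm]
    exact mul_le_mul_of_nonneg_right ((hM x hx).trans (le_max_left _ _)) (pow_nonneg (hg0 x) n)
  · simp [hgs x hx, hn]

lemma deriv_pow_add_two {a : ℝ → ℝ} (ha : Differentiable ℝ a) (n : ℕ) (s : ℝ) :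
    deriv (fun s => a s ^ (n + 2)) s = a s ^ n * ((n + 2) * a s * deriv a s) := by
  have h : HasDerivAt (fun s => a s ^ (n + 2)) _ s := (ha s).hasDerivAt.pow (n + 2)
  rw [h.deriv]
  push_cast
  ring

lemma notMem_heisCylinder {N : ℕ} {R : ℝ} (hR : 0 < R) {t : ℝ} {η : Heis N}
    (h : (t, η) ∉ heisCylinder N R) :
    R⁻¹ ^ 2 * t ∉ Metric.ball (2 : ℝ) 1 ∨ heisDilate R⁻¹ η ∉ Metric.ball (0 : Heis N) 2 := by
  by_contra! hc
  obtain ⟨h1, h2⟩ := hc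
  obtain ⟨x, y, τ⟩ := η
  have hR2 : 0 < R ^ 2 := by positivity
  refine h ⟨?_, ?_, ?_, ?_⟩
  · rw [Real.ball_eq_Ioo, inv_pow, inv_mul_eq_div] at h1
    have h3 := (lt_div_iff₀ hR2).mp h1.1
    have h4 := (div_lt_iff₀ hR2).mp h1.2
    constructor <;> simp only <;> linarith
  all_goals
    rw [mem_ball_zero_iff, heisDilate, Prod.norm_def, Prod.norm_def] at h2
    simp only [sup_lt_iff, norm_smul, norm_inv, inv_pow, inv_mul_eq_div, norm_div, norm_pow,
      Real.norm_of_nonneg hR.le, div_lt_iff₀ hR, div_lt_iff₀ hR2] at h2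
    rw [mem_closedBall_zero_iff]
  exacts [h2.1.le, h2.2.1.le, h2.2.2.le]

/-- The exponent count behind the scaling: the bound for a global solution at scale `R`. -/
lemma exists_integral_mul_cutoff_le {N : ℕ} {p q : ℝ} (hpq : p.HolderConjugate q)
    {u₀ f : Heis N → ℝ} {u : ℝ × Heis N → ℝ} (hu : ∀ T > (0 : ℝ), IsWeakSol N p T u₀ f u) :
    ∃ φ : Heis N → ℝ, Continuous φ ∧ (∀ η, 0 ≤ φ η ∧ φ η ≤ 1) ∧
      (∀ η ∈ Metric.closedBall 0 1, φ η = 1) ∧ ∃ C : ℝ, ∀ R > 0,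
        ∫ η, f η * φ (heisDilate R⁻¹ η) ≤ C * R ^ (2 * N + 2 - 2 * q) := by
  obtain ⟨n, hn⟩ := exists_nat_ge (2 / (p - 1))
  have hp : 0 < p - 1 := sub_pos.mpr hpq.lt
  rw [div_le_iff₀ hp] at hn
  have hn0 : n ≠ 0 := by
    rintro rfl
    norm_num at hn
  let a : ContDiffBump (2 : ℝ) := ⟨1 / 2, 1, by norm_num, by norm_num⟩
  let g : ContDiffBump (0 : Heis N) := ⟨1, 2, by norm_num, by norm_num⟩
  have ha2 : ContDiff ℝ 2 a := a.contDiff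
  have hg2 : ContDiff ℝ 2 g := g.contDiff
  have hanot (s : ℝ) (hs : s ∉ Metric.ball (2 : ℝ) 1) : a s = 0 :=
    Function.notMem_support.mp (a.support_eq ▸ hs)
  have hgnot (η : Heis N) (hs : η ∉ Metric.ball (0 : Heis N) 2) : g η = 0 :=
    Function.notMem_support.mp (g.support_eq ▸ hs)
  obtain ⟨H, hHc, hH⟩ := exists_subLaplacian_pow hg2 n
  let G : ℝ → ℝ := fun s => (n + 2) * a s * deriv a s
  have hGc : Continuous G := (continuous_const.mul ha2.continuous).mul
    (ha2.continuous_deriv (by norm_num))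
  have hG (s : ℝ) : deriv (fun s => a s ^ (n + 2)) s = a s ^ n * G s :=
    deriv_pow_add_two (ha2.differentiable (by norm_num)) n s
  obtain ⟨M₁, hM₁0, hM₁⟩ := exists_abs_pow_mul_le (isCompact_closedBall (2 : ℝ) 1) hGc
    (fun s hs => hanot s fun h => hs (Metric.ball_subset_closedBall h)) (fun s => a.nonneg) hn0
  obtain ⟨M₂, hM₂0, hM₂⟩ := exists_abs_pow_mul_le (isCompact_closedBall (0 : Heis N) 2) hHc
    (fun s hs => hgnot s fun h => hs (Metric.ball_subset_closedBall h)) (fun s => g.nonneg) hn0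
  have hA : 0 < ∫ s, a s ^ (n + 2) := by
    refine (ha2.continuous.pow _).integral_pos_of_hasCompactSupport_nonneg_nonzero (x := 2)
      ?_ (fun s => pow_nonneg a.nonneg _) ?_
    · exact a.hasCompactSupport.comp_left (g := fun x => x ^ (n + 2)) (by simp)
    · simp [a.one_of_mem_closedBall (Metric.mem_closedBall_self a.rIn_pos.le)]
  refine ⟨fun η => g η ^ (n + 2), hg2.continuous.pow _,
    fun η => ⟨pow_nonneg g.nonneg _, pow_le_one₀ g.nonneg g.le_one⟩,
    fun η hη => by simp [g.one_of_mem_closedBall hη],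
    (M₁ + M₂) ^ q * (2 * 4 ^ (2 * N + 1)) / ∫ s, a s ^ (n + 2), fun R hR => ?_⟩
  have hT : 0 < 4 * R ^ 2 := by positivity
  have hcd := contDiff_heisDilate (N := N) R⁻¹
  have hcdc := hcd.continuous
  have hac := ha2.continuous
  have hgc := hg2.continuous
  have hzero {t : ℝ} {η : Heis N} (h : (t, η) ∉ heisCylinder N R) :
      a (R⁻¹ ^ 2 * t) = 0 ∨ g (heisDilate R⁻¹ η) = 0 :=
    (notMem_heisCylinder hR h).imp (hanot _) (hgnot _)
  let ψ : ℝ × Heis N → ℝ := fun z => a (R⁻¹ ^ 2 * z.1) ^ (n + 2) * g (heisDilate R⁻¹ z.2) ^ (n + 2)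
  have hψS : ∀ z ∉ heisCylinder N R, ψ z = 0 := by
    rintro ⟨t, η⟩ h
    rcases hzero h with h | h <;> simp [ψ, h, -inv_pow]
  have hST : heisCylinder N R ⊆ Ioo 0 (4 * R ^ 2) ×ˢ univ := by
    rintro z ⟨hz, -⟩
    exact ⟨⟨(pow_pos hR 2).trans_le hz.1, hz.2.trans_lt (by nlinarith [pow_pos hR 2])⟩, trivial⟩
  have hψ : IsTestFun N (4 * R ^ 2) ψ := by
    refine ⟨?_, ?_, fun z => mul_nonneg (pow_nonneg a.nonneg _) (pow_nonneg g.nonneg _),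
      fun η => hψS _ fun h => lt_irrefl _ (hST h).1.2⟩
    · exact ((ha2.comp (contDiff_const.mul contDiff_fst)).pow _).mul
        ((hg2.comp (hcd.comp contDiff_snd)).pow _)
    · refine HasCompactSupport.of_support_subset_isCompact (isCompact_heisCylinder N R) ?_
      intro z hz
      by_contra h
      exact hz (hψS z h)
  have main := (hu _ hT).setIntegral_source_le hψ
    (fun η => hψS _ fun h => lt_irrefl _ (hST h).1.1) (isCompact_heisCylinder N R) hST hψS
    (D := fun z => R⁻¹ ^ 2 * (a (R⁻¹ ^ 2 * z.1) ^ n * G (R⁻¹ ^ 2 * z.1))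
      * g (heisDilate R⁻¹ z.2) ^ (n + 2))
    (E := fun z => a (R⁻¹ ^ 2 * z.1) ^ (n + 2) * (R⁻¹ ^ 2 *
      (g (heisDilate R⁻¹ z.2) ^ n * H (heisDilate R⁻¹ z.2))))
    (B := ((M₁ + M₂) * R⁻¹ ^ 2) ^ q)
    (fun t η => ?_) (fun t η => ?_) (by fun_prop) (by fun_prop) ?_ ?_ ?_
  · have hl : ∫ t in Ioo (0 : ℝ) (4 * R ^ 2), ∫ η, f η * ψ (t, η)
        = R ^ 2 * (∫ s, a s ^ (n + 2)) * ∫ η, f η * g (heisDilate R⁻¹ η) ^ (n + 2) := by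
      have h1 (t : ℝ) : ∫ η, f η * ψ (t, η) = a (R⁻¹ ^ 2 * t) ^ (n + 2)
          * ∫ η, f η * g (heisDilate R⁻¹ η) ^ (n + 2) := by
        rw [← integral_const_mul]
        congr 1 with η
        simp only [ψ]
        ring
      simp only [h1]
      rw [integral_mul_const, setIntegral_eq_integral_of_forall_compl_eq_zero,
        Measure.integral_comp_mul_left (fun s => a s ^ (n + 2)) (R⁻¹ ^ 2), smul_eq_mul,
        abs_of_pos (by positivity), inv_pow, inv_inv]
      intro t ht
      have hb : R⁻¹ ^ 2 * t ∉ Metric.ball (2 : ℝ) 1 := by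
        intro hb
        rw [Real.ball_eq_Ioo, inv_pow, inv_mul_eq_div] at hb
        have h3 := (lt_div_iff₀ (pow_pos hR 2)).mp hb.1
        have h4 := (div_lt_iff₀ (pow_pos hR 2)).mp hb.2
        have := pow_pos hR 2
        exact ht ⟨by linarith, by linarith⟩
      simp [hanot _ hb, -inv_pow]
    rw [hl, volume_real_heisCylinder N hR, Real.mul_rpow (by positivity) (by positivity)] at main
    have hRq : (R⁻¹ ^ 2) ^ q * R ^ (2 * N + 2) = R ^ (2 * N + 2 - 2 * q : ℝ) := by
      rw [inv_pow, Real.inv_rpow (by positivity), ← Real.rpow_natCast R 2, ← Real.rpow_mul hR.le,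
        ← Real.rpow_neg hR.le, ← Real.rpow_natCast R (2 * N + 2), ← Real.rpow_add hR]
      congr 1
      push_cast
      ring
    rw [← hRq, div_mul_eq_mul_div, le_div_iff₀ hA]
    refine le_of_mul_le_mul_left ?_ (pow_pos hR 2)
    calc _ = R ^ 2 * (∫ s, a s ^ (n + 2)) * ∫ η, f η * g (heisDilate R⁻¹ η) ^ (n + 2) := by ring
      _ ≤ _ := main
      _ = _ := by ring
  · have h1 : deriv (fun s => a (R⁻¹ ^ 2 * s) ^ (n + 2)) t
        = R⁻¹ ^ 2 * (a (R⁻¹ ^ 2 * t) ^ n * G (R⁻¹ ^ 2 * t)) := by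
      rw [deriv_comp_mul_left (R⁻¹ ^ 2) (fun s => a s ^ (n + 2)) t, hG, smul_eq_mul]
    simp only [ψ]
    rw [deriv_mul_const_field, h1]
  · simp only [ψ]
    rw [subLaplacian_const_mul, subLaplacian_comp_heisDilate R⁻¹ (fun ξ => g ξ ^ (n + 2)), hH]
  · rintro ⟨t, η⟩ h
    rcases hzero h with h | h <;> simp [h, hn0, -inv_pow]
  · rintro ⟨t, η⟩ h
    rcases hzero h with h | h <;> simp [h, hn0, -inv_pow]
  · rintro U hU ⟨t, η⟩
    have ha0 : 0 ≤ a (R⁻¹ ^ 2 * t) := a.nonneg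
    have ha1 : a (R⁻¹ ^ 2 * t) ≤ 1 := a.le_one
    have hg0 : 0 ≤ g (heisDilate R⁻¹ η) := g.nonneg
    have hg1 : g (heisDilate R⁻¹ η) ≤ 1 := g.le_one
    have b1 := hM₁ (R⁻¹ ^ 2 * t)
    have b2 := hM₂ (heisDilate R⁻¹ η)
    simp only [ψ]
    generalize a (R⁻¹ ^ 2 * t) = x at *
    generalize g (heisDilate R⁻¹ η) = y at *
    generalize G (R⁻¹ ^ 2 * t) = X at *
    generalize H (heisDilate R⁻¹ η) = Y at *
    rw [← mul_pow]
    refine le_trans ?_ (mul_mul_pow_le_rpow_mul_pow_add hpq hn (mul_nonneg ha0 hg0)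
      (mul_le_one₀ ha1 hg0 hg1) hU (by positivity))
    gcongr
    refine (abs_add_le _ _).trans ?_
    rw [abs_mul (R⁻¹ ^ 2 * (x ^ n * X)), abs_mul (x ^ (n + 2)), abs_mul (R⁻¹ ^ 2) (x ^ n * X),
      abs_mul (R⁻¹ ^ 2) (y ^ n * Y), abs_of_nonneg (pow_nonneg hg0 (n + 2)),
      abs_of_nonneg (pow_nonneg ha0 (n + 2)), abs_of_nonneg (by positivity : 0 ≤ R⁻¹ ^ 2)]
    have hx : x ^ (n + 2) ≤ x ^ n := pow_le_pow_of_le_one ha0 ha1 (by omega)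
    have hy : y ^ (n + 2) ≤ y ^ n := pow_le_pow_of_le_one hg0 hg1 (by omega)
    calc _ ≤ R⁻¹ ^ 2 * (M₁ * x ^ n) * y ^ n + x ^ n * (R⁻¹ ^ 2 * (M₂ * y ^ n)) := by gcongr
      _ = _ := by ring

/-- subcritical case: for `1 < p < Q/(Q−2)` with `Q = 2N+2`, nonnegative
`u₀ ∈ L¹_loc` and `f ∈ L¹` with `∫ f > 0`, the problem `u_t − Δ_ℍ u = |u|^p + f`,
`u(0,·) = u₀`, admits no global weak solution. -/
theorem no_global_weak_solution_subcritical {N : ℕ} (hN : 1 ≤ N) (p : ℝ)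
    (hp1 : 1 < p) (hp2 : p < (2 * (N : ℝ) + 2) / ((2 * (N : ℝ) + 2) - 2))
    (u₀ : Heis N → ℝ) (hu₀ : LocallyIntegrable u₀ (volume : Measure (Heis N)))
    (hu₀0 : ∀ η, 0 ≤ u₀ η)
    (f : Heis N → ℝ) (hf : Integrable f (volume : Measure (Heis N)))
    (hfpos : 0 < ∫ η : Heis N, f η) :
    ¬ ∃ u : ℝ × Heis N → ℝ,
        LocallyIntegrableOn (fun z => |u z| ^ p)
          (Ioi (0 : ℝ) ×ˢ (univ : Set (Heis N))) volume ∧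
        ∀ T > (0 : ℝ), IsWeakSol N p T u₀ f u := by
  rintro ⟨u, -, hu⟩
  have hpq : p.HolderConjugate (Real.conjExponent p) := Real.HolderConjugate.conjExponent hp1
  set q := Real.conjExponent p with hq
  obtain ⟨φ, hφc, hφ, hφ1, C, hC⟩ := exists_integral_mul_cutoff_le hpq hu
  have hN0 : (0 : ℝ) < N := by exact_mod_cast hN
  have hexp : 2 * (N : ℝ) + 2 - 2 * q < 0 := by
    have h1 : p * (2 * N) < 2 * N + 2 := by
      rwa [add_sub_cancel_right, lt_div_iff₀ (by positivity)] at hp2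
    have h2 : (N : ℝ) + 1 < q := by
      rw [hq, Real.conjExponent, lt_div_iff₀ (by linarith)]
      linarith
    linarith
  have hlim : Filter.Tendsto (fun R : ℝ => ∫ η, f η * φ (heisDilate R⁻¹ η)) Filter.atTop
      (nhds (∫ η, f η)) := by
    refine tendsto_integral_filter_of_dominated_convergence (fun η => ‖f η‖) ?_ ?_ hf.norm ?_
    · exact Filter.Eventually.of_forall fun R => hf.aestronglyMeasurable.mul
        (hφc.comp (contDiff_heisDilate R⁻¹).continuous).aestronglyMeasurable
    · refine Filter.Eventually.of_forall fun R => Filter.Eventually.of_forall fun η => ?_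
      rw [norm_mul, Real.norm_of_nonneg (hφ _).1]
      exact mul_le_of_le_one_right (norm_nonneg _) (hφ _).2
    · refine Filter.Eventually.of_forall fun η => ?_
      have hdil : Filter.Tendsto (fun R : ℝ => heisDilate R⁻¹ η) Filter.atTop (nhds 0) := by
        have hcont : Continuous fun c : ℝ => heisDilate c η := by
          unfold heisDilate
          fun_prop
        have h0 : heisDilate 0 η = 0 := by simp [heisDilate]
        exact h0 ▸ (hcont.tendsto 0).comp tendsto_inv_atTop_zero
      refine tendsto_const_nhds.congr' ?_
      filter_upwards [hdil.eventually (Metric.closedBall_mem_nhds 0 one_pos)] with R hR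
      rw [hφ1 _ hR, mul_one]
  have hbound : Filter.Tendsto (fun R : ℝ => C * R ^ (2 * (N : ℝ) + 2 - 2 * q)) Filter.atTop
      (nhds 0) := by
    have h := (tendsto_rpow_neg_atTop (neg_pos.mpr hexp)).const_mul C
    rwa [neg_neg, mul_zero] at h
  refine hfpos.not_ge (le_of_tendsto_of_tendsto hlim hbound ?_)
  filter_upwards [Filter.eventually_gt_atTop 0] with R hR using hC R hR
end
end

section
/- Let N ≥ 1, Q = 2N + 2, and let p = Q/(Q − 2). Let u₀ ∈ L¹_loc(ℝ^{2N+1}) be nonnegative and let f ∈ L¹(ℝ^{2N+1}) satisfy ∫_{ℝ^{2N+1}} f(η) dη > 0. Then the problem u_t − Δ_ℍ u = |u|^p + f, u(0, ·) = u₀, admits no global weak solution: there is no u ∈ L^p_loc((0, ∞) × ℝ^{2N+1}) which, for every T > 0, is a weak solution on (0, T). -/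
open MeasureTheory Real Set

noncomputable section

/-- `|x|² + |y|²`, the squared Euclidean norm of the horizontal part. -/
def horizSq {N : ℕ} (η : Heis N) : ℝ :=
  (∑ i : Fin N, (η.1 i) ^ 2) + (∑ i : Fin N, (η.2.1 i) ^ 2)

lemma heisNorm4_eq {N : ℕ} (η : Heis N) : heisNorm4 η = horizSq η ^ 2 + η.2.2 ^ 2 := rfl

lemma horizSq_nonneg {N : ℕ} (η : Heis N) : 0 ≤ horizSq η := by
  unfold horizSq; positivity

lemma heisNorm4_nonneg {N : ℕ} (η : Heis N) : 0 ≤ heisNorm4 η := by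
  rw [heisNorm4_eq]; positivity

lemma contDiff_horizSq {N : ℕ} {n : WithTop ℕ∞} : ContDiff ℝ n (horizSq (N := N)) := by
  unfold horizSq; fun_prop

lemma contDiff_heisNorm4 {N : ℕ} {n : WithTop ℕ∞} : ContDiff ℝ n (heisNorm4 (N := N)) := by
  unfold heisNorm4; fun_prop

lemma hasDerivAt_sum_sq_update {N : ℕ} (x : Fin N → ℝ) (i : Fin N) :
    HasDerivAt (fun s => ∑ j, (Function.update x i s j) ^ 2) (2 * x i) (x i) := by
  have h : ∀ j ∈ Finset.univ, HasDerivAt (fun s => (Function.update x i s j) ^ 2)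
      (2 * x j * (Pi.single i (1 : ℝ) : Fin N → ℝ) j) (x i) := by
    intro j _
    simpa using ((hasDerivAt_pi.1 (hasDerivAt_update x i (x i))) j).fun_pow 2
  simpa [Pi.single_apply] using HasDerivAt.fun_sum h

section Derivatives

variable {N : ℕ} (η : Heis N) (i : Fin N)

lemma hasDerivAt_horizSq_x :
    HasDerivAt (fun s => horizSq ((Function.update η.1 i s, η.2.1, η.2.2) : Heis N))
      (2 * η.1 i) (η.1 i) :=
  (hasDerivAt_sum_sq_update η.1 i).add_const (∑ j, η.2.1 j ^ 2)

lemma hasDerivAt_horizSq_y :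
    HasDerivAt (fun s => horizSq ((η.1, Function.update η.2.1 i s, η.2.2) : Heis N))
      (2 * η.2.1 i) (η.2.1 i) :=
  (hasDerivAt_sum_sq_update η.2.1 i).const_add (∑ j, η.1 j ^ 2)

lemma hasDerivAt_heisNorm4_x :
    HasDerivAt (fun s => heisNorm4 ((Function.update η.1 i s, η.2.1, η.2.2) : Heis N))
      (4 * horizSq η * η.1 i) (η.1 i) := by
  refine (((hasDerivAt_horizSq_x η i).pow 2).add_const (η.2.2 ^ 2)).congr_deriv ?_
  simp only [Function.update_eq_self]
  push_cast; ring

lemma hasDerivAt_heisNorm4_y :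
    HasDerivAt (fun s => heisNorm4 ((η.1, Function.update η.2.1 i s, η.2.2) : Heis N))
      (4 * horizSq η * η.2.1 i) (η.2.1 i) := by
  refine (((hasDerivAt_horizSq_y η i).pow 2).add_const (η.2.2 ^ 2)).congr_deriv ?_
  simp only [Function.update_eq_self]
  push_cast; ring

lemma hasDerivAt_heisNorm4_t :
    HasDerivAt (fun s => heisNorm4 ((η.1, η.2.1, s) : Heis N)) (2 * η.2.2) η.2.2 := by
  refine (((hasDerivAt_id η.2.2).pow 2).const_add (horizSq η ^ 2)).congr_deriv ?_
  simp

lemma hasDerivAt_comp_heisNorm4_x {H : ℝ → ℝ} {H' : ℝ} (h : HasDerivAt H H' (heisNorm4 η)) :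
    HasDerivAt (fun s => H (heisNorm4 ((Function.update η.1 i s, η.2.1, η.2.2) : Heis N)))
      (H' * (4 * horizSq η * η.1 i)) (η.1 i) :=
  HasDerivAt.comp (η.1 i) (by simpa only [Function.update_eq_self] using h)
    (hasDerivAt_heisNorm4_x η i)

lemma hasDerivAt_comp_heisNorm4_y {H : ℝ → ℝ} {H' : ℝ} (h : HasDerivAt H H' (heisNorm4 η)) :
    HasDerivAt (fun s => H (heisNorm4 ((η.1, Function.update η.2.1 i s, η.2.2) : Heis N)))
      (H' * (4 * horizSq η * η.2.1 i)) (η.2.1 i) :=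
  HasDerivAt.comp (η.2.1 i) (by simpa only [Function.update_eq_self] using h)
    (hasDerivAt_heisNorm4_y η i)

lemma hasDerivAt_comp_heisNorm4_t {H : ℝ → ℝ} {H' : ℝ} (h : HasDerivAt H H' (heisNorm4 η)) :
    HasDerivAt (fun s => H (heisNorm4 ((η.1, η.2.1, s) : Heis N))) (H' * (2 * η.2.2)) η.2.2 :=
  HasDerivAt.comp η.2.2 h (hasDerivAt_heisNorm4_t η)

end Derivatives

/-- On functions of the homogeneous norm the sub-Laplacian is an ordinary differential operator. -/
lemma subLaplacian_comp_heisNorm4 {N : ℕ} {H H₁ H₂ : ℝ → ℝ}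
    (h₁ : ∀ s, 0 ≤ s → HasDerivAt H (H₁ s) s) (h₂ : ∀ s, 0 ≤ s → HasDerivAt H₁ (H₂ s) s)
    (η : Heis N) :
    subLaplacian (fun ξ => H (heisNorm4 ξ)) η =
      8 * horizSq η * (2 * heisNorm4 η * H₂ (heisNorm4 η) + (N + 2) * H₁ (heisNorm4 η)) := by
  have hx (i : Fin N) : pdx i (fun ξ : Heis N => H (heisNorm4 ξ)) =
      fun ξ => H₁ (heisNorm4 ξ) * (4 * horizSq ξ * ξ.1 i) := funext fun ξ =>
    (hasDerivAt_comp_heisNorm4_x ξ i (h₁ _ (heisNorm4_nonneg ξ))).deriv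
  have hy (i : Fin N) : pdy i (fun ξ : Heis N => H (heisNorm4 ξ)) =
      fun ξ => H₁ (heisNorm4 ξ) * (4 * horizSq ξ * ξ.2.1 i) := funext fun ξ =>
    (hasDerivAt_comp_heisNorm4_y ξ i (h₁ _ (heisNorm4_nonneg ξ))).deriv
  have ht : pdt (fun ξ : Heis N => H (heisNorm4 ξ)) =
      fun ξ => H₁ (heisNorm4 ξ) * (2 * ξ.2.2) := funext fun ξ =>
    (hasDerivAt_comp_heisNorm4_t ξ (h₁ _ (heisNorm4_nonneg ξ))).deriv
  have h := h₂ _ (heisNorm4_nonneg η)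
  have hxx (i : Fin N) : pdx i (pdx i (fun ξ : Heis N => H (heisNorm4 ξ))) η =
      H₂ (heisNorm4 η) * (16 * horizSq η ^ 2 * η.1 i ^ 2)
        + H₁ (heisNorm4 η) * (4 * horizSq η + 8 * η.1 i ^ 2) := by
    rw [hx]
    refine (((hasDerivAt_comp_heisNorm4_x η i h).fun_mul (((hasDerivAt_horizSq_x η i).const_mul
      4).fun_mul (hasDerivAt_pi.1 (hasDerivAt_update η.1 i (η.1 i)) i))).deriv).trans ?_
    simp only [Function.update_eq_self, Pi.single_eq_same]
    ring
  have hyy (i : Fin N) : pdy i (pdy i (fun ξ : Heis N => H (heisNorm4 ξ))) η =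
      H₂ (heisNorm4 η) * (16 * horizSq η ^ 2 * η.2.1 i ^ 2)
        + H₁ (heisNorm4 η) * (4 * horizSq η + 8 * η.2.1 i ^ 2) := by
    rw [hy]
    refine (((hasDerivAt_comp_heisNorm4_y η i h).fun_mul (((hasDerivAt_horizSq_y η i).const_mul
      4).fun_mul (hasDerivAt_pi.1 (hasDerivAt_update η.2.1 i (η.2.1 i)) i))).deriv).trans ?_
    simp only [Function.update_eq_self, Pi.single_eq_same]
    ring
  have hxt (i : Fin N) : pdx i (pdt (fun ξ : Heis N => H (heisNorm4 ξ))) η =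
      H₂ (heisNorm4 η) * (8 * horizSq η * η.1 i * η.2.2) := by
    rw [ht]
    refine ((hasDerivAt_comp_heisNorm4_x η i h).mul_const (2 * η.2.2)).deriv.trans ?_
    ring
  have hyt (i : Fin N) : pdy i (pdt (fun ξ : Heis N => H (heisNorm4 ξ))) η =
      H₂ (heisNorm4 η) * (8 * horizSq η * η.2.1 i * η.2.2) := by
    rw [ht]
    refine ((hasDerivAt_comp_heisNorm4_y η i h).mul_const (2 * η.2.2)).deriv.trans ?_
    ring
  have htt : pdt (pdt (fun ξ : Heis N => H (heisNorm4 ξ))) η =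
      H₂ (heisNorm4 η) * (4 * η.2.2 ^ 2) + 2 * H₁ (heisNorm4 η) := by
    rw [ht]
    refine ((hasDerivAt_comp_heisNorm4_t η h).fun_mul
      ((hasDerivAt_id η.2.2).const_mul 2)).deriv.trans ?_
    simp only [id]
    ring
  unfold subLaplacian
  simp only [hxx, hyy, hxt, hyt, htt]
  have hsum : ∀ i : Fin N,
      H₂ (heisNorm4 η) * (16 * horizSq η ^ 2 * η.1 i ^ 2)
        + H₁ (heisNorm4 η) * (4 * horizSq η + 8 * η.1 i ^ 2)
        + (H₂ (heisNorm4 η) * (16 * horizSq η ^ 2 * η.2.1 i ^ 2)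
        + H₁ (heisNorm4 η) * (4 * horizSq η + 8 * η.2.1 i ^ 2))
        + 4 * η.2.1 i * (H₂ (heisNorm4 η) * (8 * horizSq η * η.1 i * η.2.2))
        - 4 * η.1 i * (H₂ (heisNorm4 η) * (8 * horizSq η * η.2.1 i * η.2.2))
        + 4 * (η.1 i ^ 2 + η.2.1 i ^ 2)
          * (H₂ (heisNorm4 η) * (4 * η.2.2 ^ 2) + 2 * H₁ (heisNorm4 η))
      = (16 * heisNorm4 η * H₂ (heisNorm4 η) + 16 * H₁ (heisNorm4 η))
          * (η.1 i ^ 2 + η.2.1 i ^ 2) + 8 * horizSq η * H₁ (heisNorm4 η) := by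
    intro i
    rw [heisNorm4_eq]
    ring
  rw [Finset.sum_congr rfl fun i _ => hsum i, Finset.sum_add_distrib, ← Finset.mul_sum,
    Finset.sum_add_distrib]
  change _ * horizSq η + _ = _
  simp only [Finset.sum_const, Finset.card_univ, Fintype.card_fin, nsmul_eq_mul]
  ring

lemma exists_abs_deriv_pow_le {G : ℝ → ℝ} (hG : ContDiff ℝ 2 G) (h0 : ∀ w, 0 ≤ G w)
    (h1 : ∀ w, G w ≤ 1) (hs : HasCompactSupport (deriv G)) (m : ℕ) :
    ∃ C, 0 ≤ C ∧ ∀ w, |deriv (fun s => G s ^ (m + 2)) w| ≤ C * G w ^ m ∧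
      |deriv (deriv fun s => G s ^ (m + 2)) w| ≤ C * G w ^ m := by
  have hG1 : ContDiff ℝ 1 (deriv G) := hG.deriv'
  obtain ⟨A, hA⟩ := hG1.continuous.bounded_above_of_compact_support hs
  obtain ⟨B, hB⟩ := (hG1.continuous_deriv le_rfl).bounded_above_of_compact_support hs.deriv
  simp only [Real.norm_eq_abs] at hA hB
  have hA0 : 0 ≤ A := (abs_nonneg _).trans (hA 0)
  have hB0 : 0 ≤ B := (abs_nonneg _).trans (hB 0)
  have hd (w : ℝ) : HasDerivAt G (deriv G w) w := (hG.differentiable (by norm_num) w).hasDerivAt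
  have hdd (w : ℝ) : HasDerivAt (deriv G) (deriv (deriv G) w) w :=
    (hG1.differentiable (by norm_num) w).hasDerivAt
  have e1 : deriv (fun s => G s ^ (m + 2)) = fun w => (m + 2) * G w ^ (m + 1) * deriv G w := by
    funext w
    rw [((hd w).fun_pow (m + 2)).deriv]
    push_cast; rfl
  have e2 (w : ℝ) : deriv (deriv fun s => G s ^ (m + 2)) w =
      G w ^ m * ((m + 2) * ((m + 1) * deriv G w ^ 2 + G w * deriv (deriv G) w)) := by
    rw [e1, ((((hd w).fun_pow (m + 1)).const_mul ((m : ℝ) + 2)).fun_mul (hdd w)).deriv]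
    push_cast [Nat.add_sub_cancel]; ring
  refine ⟨(m + 2) * A + (m + 2) * ((m + 1) * A ^ 2 + B), by positivity, fun w => ?_⟩
  have hm : 0 ≤ G w ^ m := pow_nonneg (h0 w) m
  have hGw : |G w| ≤ 1 := by rw [abs_of_nonneg (h0 w)]; exact h1 w
  constructor
  · rw [e1]
    have : |(m + 2) * G w ^ (m + 1) * deriv G w| = G w ^ m * ((m + 2) * (|G w| * |deriv G w|)) := by
      rw [pow_succ, abs_mul, abs_mul, abs_mul, abs_of_nonneg hm,
        abs_of_nonneg (show (0 : ℝ) ≤ m + 2 by positivity)]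
      ring
    rw [this, mul_comm _ (G w ^ m)]
    gcongr
    have : |G w| * |deriv G w| ≤ 1 * A := mul_le_mul hGw (hA w) (abs_nonneg _) zero_le_one
    have : 0 ≤ ((m : ℝ) + 2) * ((m + 1) * A ^ 2 + B) := by positivity
    nlinarith
  · rw [e2, abs_mul, abs_of_nonneg hm, mul_comm _ (G w ^ m)]
    gcongr
    rw [abs_mul, abs_of_nonneg (show (0 : ℝ) ≤ m + 2 by positivity)]
    have h3 : |(m + 1) * deriv G w ^ 2 + G w * deriv (deriv G) w| ≤ (m + 1) * A ^ 2 + B := by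
      refine (abs_add_le _ _).trans (add_le_add ?_ ?_)
      · rw [abs_mul, abs_pow, abs_of_nonneg (show (0 : ℝ) ≤ m + 1 by positivity)]
        gcongr
        exact hA w
      · rw [abs_mul]
        simpa using mul_le_mul hGw (hB w) (abs_nonneg _) zero_le_one
    have : 0 ≤ ((m : ℝ) + 2) * A := by positivity
    nlinarith [mul_le_mul_of_nonneg_left h3 (show (0 : ℝ) ≤ m + 2 by positivity)]

/-- A smooth function equal to `1` on `(-∞, 1]` and to `0` on `[2, ∞)`. -/
def spaceCutoff (w : ℝ) : ℝ := smoothTransition (2 - w)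

/-- A smooth function which is positive exactly on `(1/4, 3/4)`. -/
def timeCutoff (t : ℝ) : ℝ := smoothTransition (4 * t - 1) * smoothTransition (3 - 4 * t)

lemma contDiff_spaceCutoff : ContDiff ℝ 2 spaceCutoff :=
  (smoothTransition.contDiff (n := 2)).comp (by fun_prop : ContDiff ℝ 2 fun w : ℝ => 2 - w)

lemma contDiff_timeCutoff : ContDiff ℝ 2 timeCutoff :=
  ((smoothTransition.contDiff (n := 2)).comp
    (by fun_prop : ContDiff ℝ 2 fun t : ℝ => 4 * t - 1)).mul
  ((smoothTransition.contDiff (n := 2)).comp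
    (by fun_prop : ContDiff ℝ 2 fun t : ℝ => 3 - 4 * t))

lemma spaceCutoff_nonneg (w : ℝ) : 0 ≤ spaceCutoff w := smoothTransition.nonneg _

lemma spaceCutoff_le_one (w : ℝ) : spaceCutoff w ≤ 1 := smoothTransition.le_one _

lemma spaceCutoff_eq_one {w : ℝ} (hw : w ≤ 1) : spaceCutoff w = 1 :=
  smoothTransition.one_of_one_le (by linarith)

lemma spaceCutoff_eq_zero {w : ℝ} (hw : 2 ≤ w) : spaceCutoff w = 0 :=
  smoothTransition.zero_of_nonpos (by linarith)

lemma timeCutoff_nonneg (t : ℝ) : 0 ≤ timeCutoff t :=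
  mul_nonneg (smoothTransition.nonneg _) (smoothTransition.nonneg _)

lemma timeCutoff_le_one (t : ℝ) : timeCutoff t ≤ 1 :=
  mul_le_one₀ (smoothTransition.le_one _) (smoothTransition.nonneg _) (smoothTransition.le_one _)

lemma timeCutoff_eq_zero {t : ℝ} (ht : t ∉ Icc (1 / 4 : ℝ) (3 / 4)) : timeCutoff t = 0 := by
  rw [timeCutoff, mul_eq_zero]
  rcases lt_or_ge t (1 / 4) with h | h
  · exact .inl (smoothTransition.zero_of_nonpos (by linarith))
  · refine .inr (smoothTransition.zero_of_nonpos ?_)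
    have := not_le.1 fun h' => ht ⟨h, h'⟩
    linarith

lemma timeCutoff_pos {t : ℝ} (ht : t ∈ Ioo (1 / 4 : ℝ) (3 / 4)) : 0 < timeCutoff t :=
  mul_pos (smoothTransition.pos_of_pos (by linarith [ht.1]))
    (smoothTransition.pos_of_pos (by linarith [ht.2]))

lemma hasCompactSupport_deriv_spaceCutoff : HasCompactSupport (deriv spaceCutoff) := by
  refine .intro (isCompact_Icc (a := (1 : ℝ)) (b := 2)) fun w hw => ?_
  rcases lt_or_ge w 1 with h | h
  · have : spaceCutoff =ᶠ[nhds w] fun _ => 1 := by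
      filter_upwards [Iio_mem_nhds h] with v hv using spaceCutoff_eq_one (le_of_lt hv)
    simp [this.deriv_eq]
  · have h2 : 2 < w := not_le.1 fun h' => hw ⟨h, h'⟩
    have : spaceCutoff =ᶠ[nhds w] fun _ => 0 := by
      filter_upwards [Ioi_mem_nhds h2] with v hv using spaceCutoff_eq_zero (le_of_lt hv)
    simp [this.deriv_eq]

lemma hasCompactSupport_timeCutoff : HasCompactSupport timeCutoff :=
  .intro isCompact_Icc fun _ => timeCutoff_eq_zero

lemma deriv_spaceCutoff_pow_eq_zero {w : ℝ} (hw : w < 1) (m : ℕ) :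
    deriv (fun s => spaceCutoff s ^ m) w = 0 ∧
      deriv (deriv fun s => spaceCutoff s ^ m) w = 0 := by
  have h : (fun s => spaceCutoff s ^ m) =ᶠ[nhds w] fun _ => 1 := by
    filter_upwards [Iio_mem_nhds hw] with v hv
    rw [spaceCutoff_eq_one (le_of_lt hv), one_pow]
  have h' : deriv (fun s => spaceCutoff s ^ m) =ᶠ[nhds w] fun _ => 0 := by
    simpa using h.deriv
  exact ⟨h'.eq_of_nhds, by simp [h'.deriv_eq]⟩

lemma integral_timeCutoff_pow_pos (m : ℕ) : 0 < ∫ t in (0 : ℝ)..1, timeCutoff t ^ m := by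
  have hc : Continuous fun t => timeCutoff t ^ m := contDiff_timeCutoff.continuous.pow m
  refine intervalIntegral.integral_pos zero_lt_one hc.continuousOn
    (fun t _ => pow_nonneg (timeCutoff_nonneg t) m)
    ⟨1 / 2, by norm_num, pow_pos (timeCutoff_pos (by norm_num)) m⟩

/-- The sub-Laplacian of `E (log (1 + |η|⁴) / n)`. -/
def logProfileLaplacian {N : ℕ} (E : ℝ → ℝ) (n : ℝ) (η : Heis N) : ℝ :=
  8 * horizSq η *
    (2 * heisNorm4 η * ((deriv (deriv E) (log (1 + heisNorm4 η) / n) / n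
        - deriv E (log (1 + heisNorm4 η) / n)) / (n * (1 + heisNorm4 η) ^ 2))
      + (N + 2) * (deriv E (log (1 + heisNorm4 η) / n) / (n * (1 + heisNorm4 η))))

lemma subLaplacian_const_mul_logProfile {N : ℕ} {E : ℝ → ℝ} (hE : ContDiff ℝ 2 E) {n : ℝ}
    (hn : n ≠ 0) (c : ℝ) (η : Heis N) :
    subLaplacian (fun ξ => c * E (log (1 + heisNorm4 ξ) / n)) η =
      c * logProfileLaplacian E n η := by
  have hd (w : ℝ) : HasDerivAt E (deriv E w) w := (hE.differentiable (by norm_num) w).hasDerivAt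
  have hdd (w : ℝ) : HasDerivAt (deriv E) (deriv (deriv E) w) w :=
    ((hE.deriv' (n := 1)).differentiable (by norm_num) w).hasDerivAt
  have hlog (s : ℝ) (hs : 0 ≤ s) :
      HasDerivAt (fun s => log (1 + s) / n) (1 / (1 + s) / n) s :=
    (((hasDerivAt_id s).const_add 1).log (by simp; positivity)).div_const n
  rw [subLaplacian_comp_heisNorm4 (H := fun s => c * E (log (1 + s) / n))
    (H₁ := fun s => c * (deriv E (log (1 + s) / n) / (n * (1 + s))))
    (H₂ := fun s => c * ((deriv (deriv E) (log (1 + s) / n) / n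
      - deriv E (log (1 + s) / n)) / (n * (1 + s) ^ 2)))]
  · unfold logProfileLaplacian; ring
  · intro s hs
    have : (1 + s) ≠ 0 := by positivity
    refine (((hd _).comp s (hlog s hs)).const_mul c).congr_deriv ?_
    field_simp
  · intro s hs
    have : (1 + s) ≠ 0 := by positivity
    refine ((((hdd _).comp s (hlog s hs)).fun_div
      (((hasDerivAt_id s).const_add 1).const_mul n) (by simp; tauto)).const_mul c).congr_deriv ?_
    simp only [Function.comp_apply, id]
    field_simp

lemma continuous_log_one_add_heisNorm4 {N : ℕ} (n : ℝ) :
    Continuous fun η : Heis N => log (1 + heisNorm4 η) / n := by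
  have h := (contDiff_heisNorm4 (N := N) (n := 0)).continuous
  exact (Continuous.log (by fun_prop) fun η => by
    have := heisNorm4_nonneg η; positivity).div_const n

lemma contDiff_log_one_add_heisNorm4 {N : ℕ} {m : WithTop ℕ∞} (n : ℝ) :
    ContDiff ℝ m fun η : Heis N => log (1 + heisNorm4 η) / n :=
  (ContDiff.log (contDiff_const.add contDiff_heisNorm4) fun η => by
    have := heisNorm4_nonneg η; positivity).div_const n

lemma continuous_logProfileLaplacian {N : ℕ} {E : ℝ → ℝ} (hE : ContDiff ℝ 2 E) {n : ℝ}
    (hn : n ≠ 0) : Continuous (logProfileLaplacian (N := N) E n) := by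
  have h1 := (contDiff_heisNorm4 (N := N) (n := 0)).continuous
  have h2 := (contDiff_horizSq (N := N) (n := 0)).continuous
  have h3 := (contDiff_log_one_add_heisNorm4 (N := N) (m := 0) n).continuous
  have hE1 : ContDiff ℝ 1 (deriv E) := hE.deriv'
  have h4 := hE1.continuous.comp h3
  have h5 := (hE1.continuous_deriv le_rfl).comp h3
  have h6 (η : Heis N) : 1 + heisNorm4 η ≠ 0 := by
    have := heisNorm4_nonneg η; positivity
  simp only [Function.comp_def] at h4 h5
  unfold logProfileLaplacian
  refine (continuous_const.mul h2).mul (((continuous_const.mul h1).mul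
    (((h5.div_const n).sub h4).div (by fun_prop) fun η => ?_)).add
    (continuous_const.mul (h4.div (by fun_prop) fun η => ?_)))
  · exact mul_ne_zero hn (pow_ne_zero 2 (h6 η))
  · exact mul_ne_zero hn (h6 η)

lemma abs_logProfileLaplacian_le {N : ℕ} {E : ℝ → ℝ} {n B : ℝ} (hn : 1 ≤ n) (η : Heis N)
    (h₁ : |deriv E (log (1 + heisNorm4 η) / n)| ≤ B)
    (h₂ : |deriv (deriv E) (log (1 + heisNorm4 η) / n)| ≤ B) :
    |logProfileLaplacian E n η| ≤ 8 * (N + 6) * B / n / √(1 + heisNorm4 η) := by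
  have hρ := heisNorm4_nonneg η
  set ρ := heisNorm4 η with hρ_def
  set a := deriv E (log (1 + ρ) / n)
  set b := deriv (deriv E) (log (1 + ρ) / n)
  have hB : 0 ≤ B := (abs_nonneg _).trans h₁
  have hr : horizSq η ≤ √(1 + ρ) := by
    apply Real.le_sqrt_of_sq_le
    rw [hρ_def, heisNorm4_eq]
    nlinarith [sq_nonneg η.2.2]
  have hn0 : 0 < n := by linarith
  have hba : |b / n - a| ≤ 2 * B := by
    refine (abs_sub _ _).trans ?_
    rw [abs_div, abs_of_pos hn0]
    have : |b| / n ≤ |b| := div_le_self (abs_nonneg _) hn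
    linarith
  have h1 : |2 * ρ * ((b / n - a) / (n * (1 + ρ) ^ 2))| ≤ 4 * B / (n * (1 + ρ)) := by
    rw [abs_mul, abs_div, abs_of_nonneg (by positivity : 0 ≤ 2 * ρ),
      abs_of_pos (by positivity : 0 < n * (1 + ρ) ^ 2), ← mul_div_assoc,
      div_le_div_iff₀ (by positivity) (by positivity)]
    have : 2 * ρ * |b / n - a| ≤ (1 + ρ) * (4 * B) := by
      nlinarith [mul_le_mul_of_nonneg_left hba (by positivity : 0 ≤ 2 * ρ)]
    calc 2 * ρ * |b / n - a| * (n * (1 + ρ)) ≤ (1 + ρ) * (4 * B) * (n * (1 + ρ)) := by gcongr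
      _ = _ := by ring
  have h2 : |(N + 2) * (a / (n * (1 + ρ)))| ≤ (N + 2) * B / (n * (1 + ρ)) := by
    rw [abs_mul, abs_div, abs_of_nonneg (by positivity : (0 : ℝ) ≤ N + 2),
      abs_of_pos (by positivity : 0 < n * (1 + ρ)), ← mul_div_assoc]
    gcongr
  unfold logProfileLaplacian
  rw [abs_mul, abs_of_nonneg (mul_nonneg (by norm_num) (horizSq_nonneg η))]
  calc 8 * horizSq η * _
      ≤ 8 * √(1 + ρ) * (4 * B / (n * (1 + ρ)) + (N + 2) * B / (n * (1 + ρ))) := by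
        gcongr
        exact (abs_add_le _ _).trans (add_le_add h1 h2)
    _ = 8 * (N + 6) * B / n / √(1 + ρ) := by
        have hs : 0 < √(1 + ρ) := by positivity
        have : 1 + ρ = √(1 + ρ) ^ 2 := (Real.sq_sqrt (by positivity)).symm
        rw [div_div, ← add_div, eq_div_iff (by positivity), mul_div_assoc', div_mul_eq_mul_div,
          div_eq_iff (by positivity)]
        linear_combination (-8 * (N + 6) * B * n) * this

/-- The box `|x_i|, |y_i| ≤ a`, `|τ| ≤ a²`, which contains the homogeneous ball of radius `a`. -/
def heisBox (N : ℕ) (a : ℝ) : Set (Heis N) :=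
  Icc (fun _ => -a) (fun _ => a) ×ˢ Icc (fun _ => -a) (fun _ => a) ×ˢ Icc (-a ^ 2) (a ^ 2)

lemma isCompact_heisBox (N : ℕ) (a : ℝ) : IsCompact (heisBox N a) :=
  isCompact_Icc.prod (isCompact_Icc.prod isCompact_Icc)

lemma measurableSet_heisBox (N : ℕ) (a : ℝ) : MeasurableSet (heisBox N a) :=
  (isCompact_heisBox N a).measurableSet

lemma volume_real_heisBox (N : ℕ) {a : ℝ} (ha : 0 ≤ a) :
    (volume : Measure (Heis N)).real (heisBox N a) = 2 ^ (2 * N + 1) * (a ^ 2) ^ (N + 1) := by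
  have h : (volume : Measure (Fin N → ℝ)).real (Icc (fun _ => -a) (fun _ => a)) = (2 * a) ^ N := by
    rw [measureReal_def, Real.volume_Icc_pi_toReal (fun _ => by linarith)]
    simp only [Finset.prod_const, Finset.card_univ, Fintype.card_fin]
    ring
  rw [heisBox, Measure.volume_eq_prod, measureReal_prod_prod, Measure.volume_eq_prod,
    measureReal_prod_prod, h, Real.volume_real_Icc_of_le (by nlinarith)]
  ring

lemma mem_heisBox {N : ℕ} {η : Heis N} {a : ℝ} (ha : 0 ≤ a) (h : heisNorm4 η ≤ a ^ 4) :
    η ∈ heisBox N a := by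
  rw [heisNorm4_eq] at h
  have hr : horizSq η ≤ a ^ 2 :=
    abs_le_of_sq_le_sq' (by nlinarith [sq_nonneg η.2.2]) (by positivity) |>.2
  have hx : ∑ i, η.1 i ^ 2 ≤ a ^ 2 :=
    le_trans (le_add_of_nonneg_right (Finset.sum_nonneg fun _ _ => sq_nonneg _)) hr
  have hy : ∑ i, η.2.1 i ^ 2 ≤ a ^ 2 :=
    le_trans (le_add_of_nonneg_left (Finset.sum_nonneg fun _ _ => sq_nonneg _)) hr
  have key (x : Fin N → ℝ) (hx : ∑ i, x i ^ 2 ≤ a ^ 2) (i : Fin N) : -a ≤ x i ∧ x i ≤ a :=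
    abs_le_of_sq_le_sq' ((Finset.single_le_sum (fun j _ => sq_nonneg (x j))
      (Finset.mem_univ i)).trans hx) ha
  have ht := abs_le_of_sq_le_sq' (a := η.2.2) (b := a ^ 2)
    (by nlinarith [sq_nonneg (horizSq η)]) (by positivity)
  exact ⟨⟨fun i => (key _ hx i).1, fun i => (key _ hx i).2⟩,
    ⟨fun i => (key _ hy i).1, fun i => (key _ hy i).2⟩, by simpa using ht⟩

lemma mem_heisBox_exp {N : ℕ} {η : Heis N} {b : ℝ} (h : log (1 + heisNorm4 η) ≤ b) :
    η ∈ heisBox N (exp (b / 4)) := by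
  have hρ := heisNorm4_nonneg η
  refine mem_heisBox (exp_pos _).le ?_
  rw [← Real.exp_nat_mul, show ((4 : ℕ) : ℝ) * (b / 4) = b by push_cast; ring]
  have := (Real.log_le_iff_le_exp (by positivity)).1 h
  linarith

/-- The error term in the a priori estimate, bounding a power of `(M / n) (1 + |η|⁴)^{-1/2}` on
`n ≤ log (1 + |η|⁴) ≤ 2 n` by a sum over shells. -/
def shellError (N : ℕ) (M : ℝ) (n : ℕ) (η : Heis N) : ℝ :=
  ∑ k ∈ Finset.Icc n (2 * n),
    (heisBox N (exp (((k : ℝ) + 1) / 4))).indicator (fun _ => (M / n * exp (-k / 2)) ^ (N + 1)) η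

lemma integrable_shellError (N : ℕ) (M : ℝ) (n : ℕ) :
    Integrable (shellError N M n) := by
  unfold shellError
  refine integrable_finsetSum _ fun k _ => ?_
  rw [integrable_indicator_iff (measurableSet_heisBox _ _)]
  exact integrableOn_const (isCompact_heisBox _ _).measure_lt_top.ne

lemma shellError_nonneg (N : ℕ) {M : ℝ} (hM : 0 ≤ M) (n : ℕ) (η : Heis N) :
    0 ≤ shellError N M n η :=
  Finset.sum_nonneg fun _ _ => indicator_nonneg (fun _ _ => by positivity) _

lemma integral_shellError (N : ℕ) (M : ℝ) (n : ℕ) :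
    ∫ η, shellError N M n η =
      (n + 1) * ((M / n) ^ (N + 1) * (2 ^ (2 * N + 1) * exp (1 / 2) ^ (N + 1))) := by
  unfold shellError
  rw [integral_finsetSum]
  · have h (k : ℕ) : ∫ η, (heisBox N (exp (((k : ℝ) + 1) / 4))).indicator
        (fun _ => (M / n * exp (-k / 2)) ^ (N + 1)) η =
        (M / n) ^ (N + 1) * (2 ^ (2 * N + 1) * exp (1 / 2) ^ (N + 1)) := by
      have e : exp (((k : ℝ) + 1) / 4) ^ 2 * exp (-k / 2) = exp (1 / 2) := by
        rw [← Real.exp_nat_mul, ← Real.exp_add]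
        congr 1
        push_cast; ring
      rw [integral_indicator_const _ (measurableSet_heisBox _ _),
        volume_real_heisBox _ (exp_pos _).le, smul_eq_mul, ← e, mul_pow, mul_pow]
      ring
    rw [Finset.sum_congr rfl fun k _ => h k, Finset.sum_const, Nat.card_Icc, nsmul_eq_mul,
      show 2 * n + 1 - n = n + 1 by omega]
    push_cast; ring
  · intro k _
    rw [integrable_indicator_iff (measurableSet_heisBox _ _)]
    exact integrableOn_const (isCompact_heisBox _ _).measure_lt_top.ne

lemma pow_le_shellError {N n : ℕ} (hn : 1 ≤ n) {C K A : ℝ} (hC : 0 ≤ C) (hK : 0 ≤ K) (hA : 0 ≤ A)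
    {η : Heis N} (hη : log (1 + heisNorm4 η) ≤ 2 * n)
    (h₁ : log (1 + heisNorm4 η) < n → A ≤ C / n * exp (-n))
    (h₂ : n ≤ log (1 + heisNorm4 η) → A ≤ C / n * exp (-n) + K / n / √(1 + heisNorm4 η)) :
    A ^ (N + 1) ≤ shellError N (C + K) n η := by
  have hρ := heisNorm4_nonneg η
  have hn0 : (0 : ℝ) < n := by exact_mod_cast hn
  have key : ∃ k ∈ Finset.Icc n (2 * n), log (1 + heisNorm4 η) ≤ (k : ℝ) + 1 ∧
      A ≤ (C + K) / n * exp (-k / 2) := by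
    rcases lt_or_ge (log (1 + heisNorm4 η)) n with h | h
    · refine ⟨2 * n, by simp; omega, by push_cast; linarith, (h₁ h).trans ?_⟩
      rw [show -((2 * n : ℕ) : ℝ) / 2 = -n by push_cast; ring]
      gcongr
      linarith
    · have hl : 0 ≤ log (1 + heisNorm4 η) := hn0.le.trans h
      have hk1 := Nat.floor_le hl
      have hk2 : ⌊log (1 + heisNorm4 η)⌋₊ ≤ 2 * n := Nat.floor_le_of_le (by push_cast; exact hη)
      refine ⟨⌊log (1 + heisNorm4 η)⌋₊, Finset.mem_Icc.2 ⟨Nat.le_floor h, hk2⟩,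
        (Nat.lt_floor_add_one _).le, (h₂ h).trans ?_⟩
      set k := ⌊log (1 + heisNorm4 η)⌋₊
      have hk2' : (k : ℝ) ≤ 2 * n := by exact_mod_cast hk2
      have e1 : exp (-n) ≤ exp (-k / 2) := Real.exp_le_exp.2 (by linarith)
      have e2 : 1 / √(1 + heisNorm4 η) ≤ exp (-k / 2) := by
        rw [neg_div, Real.exp_neg, ← one_div]
        refine one_div_le_one_div_of_le (exp_pos _) (Real.le_sqrt_of_sq_le ?_)
        rw [← Real.exp_nat_mul, show ((2 : ℕ) : ℝ) * ((k : ℝ) / 2) = k by push_cast; ring]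
        exact (Real.le_log_iff_exp_le (by positivity)).1 hk1
      calc C / n * exp (-n) + K / n / √(1 + heisNorm4 η)
          = C / n * exp (-n) + K / n * (1 / √(1 + heisNorm4 η)) := by ring
        _ ≤ C / n * exp (-k / 2) + K / n * exp (-k / 2) := by gcongr
        _ = _ := by ring
  obtain ⟨k, hk, hk1, hk2⟩ := key
  calc A ^ (N + 1) ≤ ((C + K) / n * exp (-k / 2)) ^ (N + 1) := by gcongr
    _ = (heisBox N (exp (((k : ℝ) + 1) / 4))).indicator
          (fun _ => ((C + K) / n * exp (-k / 2)) ^ (N + 1)) η :=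
        by
        rw [indicator_of_mem (mem_heisBox_exp hk1)]
    _ ≤ shellError N (C + K) n η :=
        Finset.single_le_sum (f := fun k : ℕ => (heisBox N (exp (((k : ℝ) + 1) / 4))).indicator
          (fun _ => ((C + K) / n * exp (-k / 2)) ^ (N + 1)) η)
          (fun _ _ => indicator_nonneg (fun _ _ => by positivity) _) hk

lemma mul_pow_mul_le {N : ℕ} (hN : 1 ≤ N) {v s A : ℝ} (hv : 0 ≤ v) (hs : 0 ≤ s) (hA : 0 ≤ A) :
    v * s ^ (2 * N) * A ≤
      v ^ ((2 * (N : ℝ) + 2) / ((2 * (N : ℝ) + 2) - 2)) * s ^ (2 * N + 2) + A ^ (N + 1) := by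
  have hN0 : (0 : ℝ) < N := by exact_mod_cast hN
  have hN1 : (1 : ℝ) ≤ N := by exact_mod_cast hN
  rw [show (2 * (N : ℝ) + 2) / ((2 * (N : ℝ) + 2) - 2) = (N + 1) / N by
    rw [div_eq_div_iff (by linarith) hN0.ne']; ring]
  have hpq : (((N : ℝ) + 1) / N).HolderConjugate (N + 1) := by
    rw [Real.holderConjugate_iff]
    refine ⟨by rw [lt_div_iff₀ hN0]; linarith, ?_⟩
    field_simp
  have h := Real.young_inequality_of_nonneg (mul_nonneg hv (pow_nonneg hs (2 * N))) hA hpq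
  have e1 : (v * s ^ (2 * N)) ^ (((N : ℝ) + 1) / N) =
      v ^ (((N : ℝ) + 1) / N) * s ^ (2 * N + 2) := by
    rw [Real.mul_rpow hv (by positivity), ← Real.rpow_natCast s (2 * N), ← Real.rpow_mul hs,
      ← Real.rpow_natCast s (2 * N + 2)]
    congr 2
    push_cast
    field_simp
  have e2 : A ^ ((N : ℝ) + 1) = A ^ (N + 1) := by exact_mod_cast Real.rpow_natCast A (N + 1)
  rw [e1, e2] at h
  refine h.trans (add_le_add (div_le_self (by positivity) hpq.lt.le)
    (div_le_self (by positivity) (by linarith)))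

/-- Integrating a pointwise bound in the weak formulation, for a test function with support in
the interior of the time interval. -/
lemma IsWeakSol.integral_source_le {N : ℕ} {p T : ℝ} {u₀ f : Heis N → ℝ} {u : ℝ × Heis N → ℝ}
    (hu : IsWeakSol N p T u₀ f u) (hT : 0 < T) {ψ P L : ℝ × Heis N → ℝ} (hψ : ContDiff ℝ 2 ψ)
    (hψ0 : ∀ z, 0 ≤ ψ z) (hP : Continuous P) (hL : Continuous L)
    (hPψ : ∀ t η, deriv (fun s => ψ (s, η)) t = P (t, η))
    (hLψ : ∀ t η, subLaplacian (fun ξ => ψ (t, ξ)) η = L (t, η))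
    {K : Set (ℝ × Heis N)} (hK : IsCompact K) (hKT : K ⊆ Ioo 0 T ×ˢ univ)
    (hψK : ∀ z ∉ K, ψ z = 0) (hPK : ∀ z ∉ K, P z = 0) (hLK : ∀ z ∉ K, L z = 0)
    {S : Heis N → ℝ} (hS : Integrable S)
    (hbound : ∀ v z, -(v * P z) - v * L z ≤ |v| ^ p * ψ z + S z.2) :
    ∫ t in Ioo (0 : ℝ) T, ∫ η, f η * ψ (t, η) ≤ T * ∫ η, S η := by
  obtain ⟨hu1, hup, hweak⟩ := hu
  have hnot (t : ℝ) (ht : t ∉ Ioo 0 T) (η : Heis N) : ψ (t, η) = 0 :=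
    hψK _ fun h => ht (hKT h).1
  have hI {g φ : ℝ × Heis N → ℝ} (hg : LocallyIntegrableOn g (Ioo (0 : ℝ) T ×ˢ univ) volume)
      (hφ : Continuous φ) (hφK : ∀ z ∉ K, φ z = 0) :
      IntegrableOn (fun z => g z * φ z) (Ioo (0 : ℝ) T ×ˢ univ) volume := by
    have h := (hg.integrableOn_compact_subset hKT hK).mul_continuousOn hφ.continuousOn hK
    refine ((integrableOn_iff_integrable_of_support_subset ?_).1 h).integrableOn
    intro z hz
    by_contra hzK
    exact hz (by simp [hφK z hzK])
  have hIter {F : ℝ × Heis N → ℝ} (hF : IntegrableOn F (Ioo (0 : ℝ) T ×ˢ univ) volume) :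
      ∫ t in Ioo (0 : ℝ) T, ∫ η, F (t, η) = ∫ z in Ioo (0 : ℝ) T ×ˢ univ, F z := by
    refine Eq.trans ?_ (setIntegral_prod F hF).symm
    simp
  have h1 := hI hup hψ.continuous hψK
  have h2 : IntegrableOn (fun z => -(u z * P z)) (Ioo (0 : ℝ) T ×ˢ univ) volume :=
    (hI hu1 hP hPK).neg
  have h3 := hI hu1 hL hLK
  have h4 : IntegrableOn (fun z : ℝ × Heis N => S z.2) (Ioo (0 : ℝ) T ×ˢ univ) volume := by
    rw [IntegrableOn, Measure.volume_eq_prod, ← Measure.prod_restrict, Measure.restrict_univ]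
    exact hS.comp_snd _
  have e4 : ∫ z in Ioo (0 : ℝ) T ×ˢ (univ : Set (Heis N)), S z.2 = T * ∫ η, S η := by
    rw [← hIter h4]
    simp [hT.le]
  have h := hweak ψ ⟨hψ, .intro hK hψK, hψ0, hnot T (by simp)⟩
  simp only [hPψ, hLψ, hnot 0 (by simp), mul_zero, integral_zero, add_zero] at h
  rw [hIter h1, hIter (hI hu1 hP hPK), hIter h3] at h
  have hle := integral_mono (h2.sub h3) (h1.add h4) fun z => hbound (u z) z
  simp only [Pi.sub_apply, Pi.add_apply] at hle
  rw [integral_sub h2 h3, integral_neg, integral_add h1 h4, e4] at hle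
  linarith

lemma logProfileLaplacian_eq_zero {N : ℕ} {E : ℝ → ℝ} {n : ℝ} {η : Heis N}
    (h₁ : deriv E (log (1 + heisNorm4 η) / n) = 0)
    (h₂ : deriv (deriv E) (log (1 + heisNorm4 η) / n) = 0) :
    logProfileLaplacian E n η = 0 := by
  simp [logProfileLaplacian, h₁, h₂]

/-- The temporal factor of the test functions, before rescaling. -/
def timeProfile (N : ℕ) (t : ℝ) : ℝ := timeCutoff t ^ (2 * N + 2)

/-- The spatial factor of the test functions, as a function of the rescaled logarithm of the
homogeneous norm. -/
def spaceProfile (N : ℕ) (w : ℝ) : ℝ := spaceCutoff w ^ (2 * N + 2)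

lemma timeProfile_nonneg (N : ℕ) (t : ℝ) : 0 ≤ timeProfile N t := pow_nonneg (timeCutoff_nonneg t) _

lemma spaceProfile_nonneg (N : ℕ) (w : ℝ) : 0 ≤ spaceProfile N w :=
  pow_nonneg (spaceCutoff_nonneg w) _

lemma timeProfile_le (N : ℕ) (t : ℝ) : timeProfile N t ≤ timeCutoff t ^ (2 * N) :=
  pow_le_pow_of_le_one (timeCutoff_nonneg t) (timeCutoff_le_one t) (by omega)

lemma spaceProfile_le (N : ℕ) (w : ℝ) : spaceProfile N w ≤ spaceCutoff w ^ (2 * N) :=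
  pow_le_pow_of_le_one (spaceCutoff_nonneg w) (spaceCutoff_le_one w) (by omega)

lemma contDiff_timeProfile (N : ℕ) : ContDiff ℝ 2 (timeProfile N) := contDiff_timeCutoff.pow _

lemma contDiff_spaceProfile (N : ℕ) : ContDiff ℝ 2 (spaceProfile N) := contDiff_spaceCutoff.pow _

lemma exists_abs_deriv_timeProfile_le (N : ℕ) :
    ∃ C, 0 ≤ C ∧ ∀ t, |deriv (timeProfile N) t| ≤ C * timeCutoff t ^ (2 * N) := by
  obtain ⟨C, hC, h⟩ := exists_abs_deriv_pow_le contDiff_timeCutoff timeCutoff_nonneg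
    timeCutoff_le_one hasCompactSupport_timeCutoff.deriv (2 * N)
  exact ⟨C, hC, fun t => (h t).1⟩

lemma exists_abs_deriv_spaceProfile_le (N : ℕ) :
    ∃ C, 0 ≤ C ∧ ∀ w, |deriv (spaceProfile N) w| ≤ C * spaceCutoff w ^ (2 * N) ∧
      |deriv (deriv (spaceProfile N)) w| ≤ C * spaceCutoff w ^ (2 * N) :=
  exists_abs_deriv_pow_le contDiff_spaceCutoff spaceCutoff_nonneg spaceCutoff_le_one
    hasCompactSupport_deriv_spaceCutoff (2 * N)

lemma deriv_timeProfile_eq_zero {N : ℕ} {t : ℝ} (ht : t ∉ Icc (1 / 4 : ℝ) (3 / 4)) :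
    deriv (timeProfile N) t = 0 := by
  have h : timeProfile N =ᶠ[nhds t] fun _ => 0 := by
    filter_upwards [isClosed_Icc.isOpen_compl.mem_nhds ht] with s hs
    simp [timeProfile, timeCutoff_eq_zero hs]
  simp [h.deriv_eq]

lemma spaceProfile_eq_zero {N : ℕ} (hN : 1 ≤ N) {w : ℝ} (hw : 2 ≤ w) :
    spaceProfile N w = 0 ∧ deriv (spaceProfile N) w = 0 ∧
      deriv (deriv (spaceProfile N)) w = 0 := by
  obtain ⟨C, -, h⟩ := exists_abs_deriv_spaceProfile_le N
  have h := h w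
  rw [spaceCutoff_eq_zero hw, zero_pow (by omega), mul_zero, abs_nonpos_iff, abs_nonpos_iff] at h
  exact ⟨by simp [spaceProfile, spaceCutoff_eq_zero hw], h⟩

/-- The pointwise form of the a priori estimate: Young's inequality absorbs the terms linear in
the solution into `|v|^p ψ`, up to `shellError`. -/
lemma neg_mul_add_le_add_shellError {N n : ℕ} (hN : 1 ≤ N) (hn : 1 ≤ n) {C₁ C₂ : ℝ} (hC₁ : 0 ≤ C₁)
    (hC₂ : 0 ≤ C₂) (h₁ : ∀ t, |deriv (timeProfile N) t| ≤ C₁ * timeCutoff t ^ (2 * N))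
    (h₂ : ∀ w, |deriv (spaceProfile N) w| ≤ C₂ * spaceCutoff w ^ (2 * N) ∧
      |deriv (deriv (spaceProfile N)) w| ≤ C₂ * spaceCutoff w ^ (2 * N)) (v t : ℝ) (η : Heis N) :
    -(v * (deriv (timeProfile N) t / (n * exp n) * spaceProfile N (log (1 + heisNorm4 η) / n)))
      - v * (timeProfile N t * logProfileLaplacian (spaceProfile N) n η) ≤
    |v| ^ ((2 * (N : ℝ) + 2) / ((2 * (N : ℝ) + 2) - 2)) *
      (timeProfile N t * spaceProfile N (log (1 + heisNorm4 η) / n))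
      + shellError N (C₁ + 8 * (N + 6) * C₂) n η := by
  have hn1 : (1 : ℝ) ≤ n := by exact_mod_cast hn
  have hn0 : (0 : ℝ) < n := by linarith
  set w := log (1 + heisNorm4 η) / n with hw_def
  have hM : 0 ≤ C₁ + 8 * (N + 6) * C₂ := by positivity
  rcases le_or_gt 2 w with hw | hw
  · have hz := spaceProfile_eq_zero hN hw
    simp [hz.1, logProfileLaplacian_eq_zero hz.2.1 hz.2.2, shellError_nonneg N hM]
  set s := timeCutoff t * spaceCutoff w with hs_def
  have hs : 0 ≤ s := mul_nonneg (timeCutoff_nonneg _) (spaceCutoff_nonneg _)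
  have hT' : 1 / ((n : ℝ) * exp n) = 1 / n * exp (-n) := by
    rw [Real.exp_neg]; field_simp
  set A := C₁ / n * exp (-n) + if 1 ≤ w then 8 * (N + 6) * C₂ / n / √(1 + heisNorm4 η) else 0
    with hA_def
  have hA : 0 ≤ A := by
    rw [hA_def]; split_ifs <;> positivity
  have hθ0 := timeCutoff_nonneg t
  have hχ0 := spaceCutoff_nonneg w
  have hP : |deriv (timeProfile N) t / (n * exp n) * spaceProfile N w| ≤
      s ^ (2 * N) * (C₁ / n * exp (-n)) := by
    have hT : (0 : ℝ) < n * exp n := by positivity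
    rw [abs_mul, abs_div, abs_of_pos hT, abs_of_nonneg (spaceProfile_nonneg N w)]
    calc |deriv (timeProfile N) t| / (n * exp n) * spaceProfile N w
        ≤ C₁ * timeCutoff t ^ (2 * N) / (n * exp n) * spaceCutoff w ^ (2 * N) :=
          mul_le_mul (div_le_div_of_nonneg_right (h₁ t) hT.le) (spaceProfile_le N w)
            (spaceProfile_nonneg N w) (by positivity)
      _ = timeCutoff t ^ (2 * N) * spaceCutoff w ^ (2 * N) * C₁ * (1 / (n * exp n)) := by ring
      _ = _ := by rw [hT', hs_def, mul_pow]; ring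
  have hL : |timeProfile N t * logProfileLaplacian (spaceProfile N) n η| ≤ s ^ (2 * N) *
      if 1 ≤ w then 8 * (N + 6) * C₂ / n / √(1 + heisNorm4 η) else 0 := by
    split_ifs with h
    · rw [abs_mul, abs_of_nonneg (timeProfile_nonneg N t)]
      calc timeProfile N t * |logProfileLaplacian (spaceProfile N) n η|
          ≤ timeCutoff t ^ (2 * N) * (8 * (N + 6) * (C₂ * spaceCutoff w ^ (2 * N)) / n
              / √(1 + heisNorm4 η)) := by
            exact mul_le_mul (timeProfile_le N t)
              (abs_logProfileLaplacian_le hn1 _ (h₂ w).1 (h₂ w).2) (abs_nonneg _) (by positivity)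
        _ = _ := by rw [hs_def, mul_pow]; ring
    · have := deriv_spaceCutoff_pow_eq_zero (not_le.1 h) (2 * N + 2)
      simp [logProfileLaplacian_eq_zero (E := spaceProfile N) this.1 this.2]
  have hAS : A ^ (N + 1) ≤ shellError N (C₁ + 8 * (N + 6) * C₂) n η := by
    refine pow_le_shellError hn hC₁ (by positivity) hA ((div_le_iff₀ hn0).1 hw.le) ?_ ?_
    · intro h
      have : ¬ 1 ≤ w := not_le.2 ((div_lt_one hn0).2 h)
      simp [hA_def, this]
    · intro h
      have : 1 ≤ w := (one_le_div hn0).2 h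
      simp [hA_def, this]
  have hψ : timeProfile N t * spaceProfile N w = s ^ (2 * N + 2) := (mul_pow _ _ _).symm
  refine le_trans ?_ ((mul_pow_mul_le hN (abs_nonneg v) hs hA).trans
    (add_le_add (le_of_eq (by rw [hψ])) hAS))
  set a := deriv (timeProfile N) t / (n * exp n) * spaceProfile N w
  set b := timeProfile N t * logProfileLaplacian (spaceProfile N) n η
  calc -(v * a) - v * b ≤ |v| * (|a| + |b|) := by
        rw [mul_add, ← abs_mul, ← abs_mul]
        linarith [neg_abs_le (v * a), neg_abs_le (v * b)]
    _ ≤ |v| * (s ^ (2 * N) * A) := by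
        rw [hA_def, mul_add (s ^ (2 * N))]
        exact mul_le_mul_of_nonneg_left (add_le_add hP hL) (abs_nonneg v)
    _ = |v| * s ^ (2 * N) * A := by ring

/-- The a priori estimate obtained from the test functions
`θ(t/T)^{2N+2} χ(log(1 + |η|⁴)/n)^{2N+2}` with `T = n eⁿ`. -/
lemma exists_integral_mul_spaceProfile_le {N : ℕ} (hN : 1 ≤ N) :
    ∃ M : ℝ, ∀ (u₀ f : Heis N → ℝ) (u : ℝ × Heis N → ℝ) (n : ℕ), 1 ≤ n →
      IsWeakSol N ((2 * (N : ℝ) + 2) / ((2 * (N : ℝ) + 2) - 2)) (n * exp n) u₀ f u →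
      (∫ t in (0 : ℝ)..1, timeProfile N t) *
        ∫ η, f η * spaceProfile N (log (1 + heisNorm4 η) / n) ≤ ∫ η, shellError N M n η := by
  obtain ⟨C₁, hC₁, h₁⟩ := exists_abs_deriv_timeProfile_le N
  obtain ⟨C₂, hC₂, h₂⟩ := exists_abs_deriv_spaceProfile_le N
  refine ⟨C₁ + 8 * (N + 6) * C₂, fun u₀ f u n hn hu => ?_⟩
  have hpoint := neg_mul_add_le_add_shellError hN hn hC₁ hC₂ h₁ h₂
  have hn0 : (0 : ℝ) < n := by exact_mod_cast hn
  have hT : (0 : ℝ) < n * exp n := by positivity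
  generalize (n : ℝ) * exp n = T at hu hT hpoint
  have hΘ := contDiff_timeProfile N
  have hE := contDiff_spaceProfile N
  have hnotK {z : ℝ × Heis N} (hz : z ∉ Icc (T / 4) (3 * T / 4) ×ˢ heisBox N (exp (2 * n / 4))) :
      z.1 / T ∉ Icc (1 / 4 : ℝ) (3 / 4) ∨ 2 ≤ log (1 + heisNorm4 z.2) / n := by
    by_contra! h
    refine hz ⟨⟨?_, ?_⟩, mem_heisBox_exp ((div_lt_iff₀ hn0).1 h.2).le⟩
    · have := (le_div_iff₀ hT).1 h.1.1
      linarith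
    · have := (div_le_iff₀ hT).1 h.1.2
      linarith
  have hΘd (t : ℝ) : HasDerivAt (fun s => timeProfile N (s / T))
      (deriv (timeProfile N) (t / T) / T) t := by
    refine (((hΘ.differentiable (by norm_num) (t / T)).hasDerivAt).comp t
      ((hasDerivAt_id t).div_const T)).congr_deriv ?_
    ring
  have cT : ContDiff ℝ 2 fun z : ℝ × Heis N => z.1 / T := contDiff_fst.div_const T
  have cΘ : ContDiff ℝ 2 fun z : ℝ × Heis N => timeProfile N (z.1 / T) := hΘ.comp cT
  have cE : ContDiff ℝ 2 fun z : ℝ × Heis N => spaceProfile N (log (1 + heisNorm4 z.2) / n) :=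
    hE.comp ((contDiff_log_one_add_heisNorm4 (n : ℝ)).comp contDiff_snd)
  have cΘ' : Continuous fun z : ℝ × Heis N => deriv (timeProfile N) (z.1 / T) / T :=
    ((hΘ.continuous_deriv (by norm_num)).comp cT.continuous).div_const T
  have cL : Continuous fun z : ℝ × Heis N => logProfileLaplacian (spaceProfile N) (n : ℝ) z.2 :=
    (continuous_logProfileLaplacian hE hn0.ne').comp continuous_snd
  have cψ : ContDiff ℝ 2 fun z : ℝ × Heis N =>
      timeProfile N (z.1 / T) * spaceProfile N (log (1 + heisNorm4 z.2) / n) := cΘ.mul cE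
  have cP : Continuous fun z : ℝ × Heis N => deriv (timeProfile N) (z.1 / T) / T *
      spaceProfile N (log (1 + heisNorm4 z.2) / n) := cΘ'.mul cE.continuous
  have cψL : Continuous fun z : ℝ × Heis N =>
      timeProfile N (z.1 / T) * logProfileLaplacian (spaceProfile N) n z.2 := cΘ.continuous.mul cL
  have hderiv (t : ℝ) (η : Heis N) : deriv (fun s => timeProfile N (s / T) *
      spaceProfile N (log (1 + heisNorm4 η) / n)) t =
        deriv (timeProfile N) (t / T) / T * spaceProfile N (log (1 + heisNorm4 η) / n) :=
    ((hΘd t).mul_const _).deriv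
  have hlap (t : ℝ) (η : Heis N) : subLaplacian (fun ξ : Heis N => timeProfile N (t / T) *
      spaceProfile N (log (1 + heisNorm4 ξ) / n)) η =
        timeProfile N (t / T) * logProfileLaplacian (spaceProfile N) n η :=
    subLaplacian_const_mul_logProfile hE hn0.ne' _ η
  have hbound := hu.integral_source_le hT cψ
    (fun z => mul_nonneg (timeProfile_nonneg N _) (spaceProfile_nonneg N _)) cP cψL hderiv hlap
    (isCompact_Icc.prod (isCompact_heisBox _ _))
    (fun z hz => ⟨⟨by linarith [hz.1.1], by linarith [hz.1.2]⟩, trivial⟩)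
    (fun z hz => (hnotK hz).elim (fun h => by simp [timeProfile, timeCutoff_eq_zero h])
      fun h => by simp [(spaceProfile_eq_zero hN h).1])
    (fun z hz => (hnotK hz).elim (fun h => by simp [deriv_timeProfile_eq_zero h])
      fun h => by simp [(spaceProfile_eq_zero hN h).1])
    (fun z hz => (hnotK hz).elim (fun h => by simp [timeProfile, timeCutoff_eq_zero h])
      fun h => by
        have := (spaceProfile_eq_zero hN h).2
        simp [logProfileLaplacian_eq_zero this.1 this.2])
    (integrable_shellError N (C₁ + 8 * (N + 6) * C₂) n)
    (fun v z => hpoint v (z.1 / T) z.2)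
  refine le_of_mul_le_mul_left (le_of_eq_of_le ?_ hbound) hT
  simp_rw [mul_left_comm (f _), integral_const_mul]
  rw [integral_mul_const, ← integral_Ioc_eq_integral_Ioo,
    ← intervalIntegral.integral_of_le hT.le, intervalIntegral.integral_comp_div _ hT.ne',
    zero_div, div_self hT.ne', smul_eq_mul, mul_assoc]

lemma tendsto_integral_shellError {N : ℕ} (hN : 1 ≤ N) (M : ℝ) :
    Filter.Tendsto (fun n : ℕ => ∫ η, shellError N M n η) Filter.atTop (nhds 0) := by
  set c : ℝ := M ^ (N + 1) * (2 ^ (2 * N + 1) * exp (1 / 2) ^ (N + 1))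
  have h1 : Filter.Tendsto (fun n : ℕ => (n : ℝ)⁻¹) Filter.atTop (nhds 0) :=
    tendsto_inv_atTop_nhds_zero_nat
  have h2 : Filter.Tendsto (fun n : ℕ => c * ((1 + (n : ℝ)⁻¹) * (n : ℝ)⁻¹ ^ N)) Filter.atTop
      (nhds (c * ((1 + 0) * 0 ^ N))) :=
    ((h1.const_add 1).mul (h1.pow N)).const_mul c
  rw [zero_pow (by omega), mul_zero, mul_zero] at h2
  refine h2.congr' ?_
  filter_upwards [Filter.eventually_gt_atTop 0] with n hn
  have hn0 : (n : ℝ) ≠ 0 := by exact_mod_cast hn.ne'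
  rw [integral_shellError, div_pow, pow_succ (n : ℝ), inv_pow]
  field_simp
  ring

lemma tendsto_integral_mul_spaceCutoff {N : ℕ} {f : Heis N → ℝ} (hf : Integrable f) (m : ℕ) :
    Filter.Tendsto (fun n : ℕ => ∫ η, f η * spaceCutoff (log (1 + heisNorm4 η) / n) ^ m)
      Filter.atTop (nhds (∫ η, f η)) := by
  refine tendsto_integral_of_dominated_convergence (fun η => ‖f η‖) (fun n => ?_) hf.norm
    (fun n => .of_forall fun η => ?_) (.of_forall fun η => ?_)
  · exact hf.aestronglyMeasurable.mul ((contDiff_spaceCutoff.continuous.comp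
      (continuous_log_one_add_heisNorm4 (n : ℝ))).pow m).aestronglyMeasurable
  · rw [norm_mul, norm_pow, Real.norm_of_nonneg (spaceCutoff_nonneg _)]
    exact mul_le_of_le_one_right (norm_nonneg _)
      (pow_le_one₀ (spaceCutoff_nonneg _) (spaceCutoff_le_one _))
  · refine tendsto_const_nhds.congr' ?_
    filter_upwards [Filter.eventually_ge_atTop (max 1 ⌈log (1 + heisNorm4 η)⌉₊)] with n hn
    have hn1 : (1 : ℝ) ≤ n := by exact_mod_cast (le_max_left _ _).trans hn
    have hn2 : log (1 + heisNorm4 η) ≤ n := Nat.ceil_le.1 ((le_max_right _ _).trans hn)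
    rw [spaceCutoff_eq_one ((div_le_one (by linarith)).2 hn2), one_pow, mul_one]

/-- critical case: for `p = Q/(Q−2)` with `Q = 2N+2`, nonnegative
`u₀ ∈ L¹_loc` and `f ∈ L¹` with `∫ f > 0`, the problem `u_t − Δ_ℍ u = |u|^p + f`,
`u(0,·) = u₀`, admits no global weak solution. -/
theorem no_global_weak_solution_critical {N : ℕ} (hN : 1 ≤ N) (p : ℝ)
    (hp : p = (2 * (N : ℝ) + 2) / ((2 * (N : ℝ) + 2) - 2))
    (u₀ : Heis N → ℝ) (hu₀ : LocallyIntegrable u₀ (volume : Measure (Heis N)))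
    (hu₀0 : ∀ η, 0 ≤ u₀ η)
    (f : Heis N → ℝ) (hf : Integrable f (volume : Measure (Heis N)))
    (hfpos : 0 < ∫ η : Heis N, f η) :
    ¬ ∃ u : ℝ × Heis N → ℝ,
        LocallyIntegrableOn (fun z => |u z| ^ p)
          (Ioi (0 : ℝ) ×ˢ (univ : Set (Heis N))) volume ∧
        ∀ T > (0 : ℝ), IsWeakSol N p T u₀ f u := by
  rintro ⟨u, -, hu⟩
  obtain ⟨M, hM⟩ := exists_integral_mul_spaceProfile_le hN
  have hle := le_of_tendsto_of_tendsto
    ((tendsto_integral_mul_spaceCutoff hf (2 * N + 2)).const_mul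
      (∫ t in (0 : ℝ)..1, timeProfile N t))
    (tendsto_integral_shellError hN M) (by
      filter_upwards [Filter.eventually_ge_atTop 1] with n hn
      have hn0 : (0 : ℝ) < n := by exact_mod_cast hn
      exact hM u₀ f u n hn (hp ▸ hu (n * exp n) (by positivity)))
  exact absurd hle (not_le.2 (mul_pos (integral_timeCutoff_pow_pos _) hfpos))
end
end
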